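/- For every 1 < p < ∞ there exists a constant C > 0 such that for every u ∈ C_c^∞(ℝ^N; ℝ): ‖ (1+|x|^{α−1}) ∇u ‖_{L^p(ℝ^N)} ≤ C ( ‖Au‖_{L^p(ℝ^N)} + ‖u‖_{L^p(ℝ^N)} ), where (1+|x|^{α−1})∇u denotes the function x ↦ (1+|x|^{α−1})|∇u(x)|. -/

import Mathlib

open Real MeasureTheory Metric
open scoped ENNReal NNReal

/-- The `i`-th partial derivative of `u` at `x`. -/
noncomputable def pd {N : ℕ} {F : Type*} [NormedAddCommGroup F] [NormedSpace ℝ F]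
    (u : EuclideanSpace ℝ (Fin N) → F) (i : Fin N) (x : EuclideanSpace ℝ (Fin N)) : F :=
  fderiv ℝ u x (EuclideanSpace.single i 1)

/-- The Laplacian of `u` at `x`. -/
noncomputable def lap {N : ℕ} {F : Type*} [NormedAddCommGroup F] [NormedSpace ℝ F]
    (u : EuclideanSpace ℝ (Fin N) → F) (x : EuclideanSpace ℝ (Fin N)) : F :=
  ∑ i, pd (pd u i) i x

/-- The elliptic operator `Au = (1+|x|^α)Δu + b|x|^{α-2} x·∇u - c|x|^β u`. -/
noncomputable def opA {N : ℕ} (α β b c : ℝ) (u : EuclideanSpace ℝ (Fin N) → ℝ)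
    (x : EuclideanSpace ℝ (Fin N)) : ℝ :=
  (1 + ‖x‖ ^ α) * lap u x + b * ‖x‖ ^ (α - 2) * (∑ i, x i * pd u i x)
    - c * ‖x‖ ^ β * u x

theorem T_anti {N : ℕ} (ε : ℝ) (hε0 : 0 ≤ ε) (hε : ε ≤ 1/2) (z : EuclideanSpace ℝ (Fin N))
    (hz : ‖z‖ ≤ 1) :
    AntilipschitzWith 2 (fun x : EuclideanSpace ℝ (Fin N) => x + (ε * (1 + ‖x‖)) • z) := by
  apply AntilipschitzWith.of_le_mul_dist
  intro x y
  rw [dist_eq_norm, dist_eq_norm]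
  have h1 : x + (ε * (1 + ‖x‖)) • z - (y + (ε * (1 + ‖y‖)) • z)
      = (x - y) + (ε * (‖x‖ - ‖y‖)) • z := by module
  rw [h1]
  have h2 : ‖(ε * (‖x‖ - ‖y‖)) • z‖ ≤ 1/2 * ‖x - y‖ := by
    rw [norm_smul, norm_mul, Real.norm_of_nonneg hε0, Real.norm_eq_abs]
    have := abs_norm_sub_norm_le x y
    calc ε * |‖x‖ - ‖y‖| * ‖z‖ ≤ 1/2 * ‖x - y‖ * 1 := by gcongr
      _ = _ := by ring
  have h3 : ‖x - y‖ ≤ ‖(x - y) + (ε * (‖x‖ - ‖y‖)) • z‖ + ‖(ε * (‖x‖ - ‖y‖)) • z‖ := by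
    have := norm_sub_le ((x - y) + (ε * (‖x‖ - ‖y‖)) • z) ((ε * (‖x‖ - ‖y‖)) • z)
    simpa using this
  simp only [NNReal.coe_ofNat]
  linarith

theorem vol_preimage_le {N : ℕ} {T : EuclideanSpace ℝ (Fin N) → EuclideanSpace ℝ (Fin N)}
    (hT : AntilipschitzWith 2 T) (s : Set (EuclideanSpace ℝ (Fin N))) :
    volume (T ⁻¹' s) ≤ 2 ^ N * volume s := by
  have hH : Measure.IsAddHaarMeasure (μH[(N : ℝ)] : Measure (EuclideanSpace ℝ (Fin N))) := by
    have := isAddHaarMeasure_hausdorffMeasure (E := EuclideanSpace ℝ (Fin N))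
    simpa using this
  have h := Measure.isAddLeftInvariant_eq_smul (volume : Measure (EuclideanSpace ℝ (Fin N)))
    (μH[(N : ℝ)])
  rw [h]
  have h2 := hT.hausdorffMeasure_preimage_le (d := (N : ℝ)) (by positivity) s
  rw [ENNReal.rpow_natCast] at h2
  simp only [Measure.smul_apply]
  simp only [ENNReal.smul_def, smul_eq_mul]
  calc _ ≤ _ := mul_le_mul_right h2 _
    _ = _ := by push_cast; ring

theorem lintegral_T_le {N : ℕ} {T : EuclideanSpace ℝ (Fin N) → EuclideanSpace ℝ (Fin N)}
    (hT : AntilipschitzWith 2 T) (hTm : Measurable T) {g : EuclideanSpace ℝ (Fin N) → ℝ≥0∞}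
    (hg : Measurable g) :
    ∫⁻ x, g (T x) ≤ 2 ^ N * ∫⁻ x, g x := by
  rw [← lintegral_map hg hTm]
  have : Measure.map T volume ≤ (2 ^ N : ℝ≥0∞) • volume := by
    apply Measure.le_iff.2
    intro s hs
    rw [Measure.map_apply hTm hs]
    simpa using vol_preimage_le hT s
  calc _ ≤ ∫⁻ x, g x ∂((2 ^ N : ℝ≥0∞) • volume) := lintegral_mono' this le_rfl
    _ = _ := by rw [lintegral_smul_measure]; rfl

theorem jensen_l {Y : Type*} [MeasurableSpace Y] (ν : Measure Y) {f : Y → ℝ≥0∞}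
    (hf : Measurable f) (q : ℝ) (hq : 1 < q) :
    (∫⁻ y, f y ∂ν) ^ q ≤ ν Set.univ ^ (q - 1) * ∫⁻ y, f y ^ q ∂ν := by
  have hc := Real.HolderConjugate.conjExponent hq
  have h := ENNReal.lintegral_mul_le_Lp_mul_Lq ν hc hf.aemeasurable
    (aemeasurable_const (b := (1 : ℝ≥0∞)))
  have hq0 : 0 < q := by linarith
  simp only [Pi.mul_apply, mul_one, ENNReal.one_rpow, lintegral_const, one_mul] at h
  calc _ ≤ _ := ENNReal.rpow_le_rpow h hq0.le
    _ = _ := by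
      rw [ENNReal.mul_rpow_of_nonneg _ _ hq0.le, ← ENNReal.rpow_mul, ← ENNReal.rpow_mul, mul_comm]
      congr 2
      · simp only [Real.conjExponent]; field_simp
      · rw [one_div, inv_mul_cancel₀ hq0.ne', ENNReal.rpow_one]

theorem avg_le {N : ℕ} {Y : Type*} [MeasurableSpace Y] (ν : Measure Y) [IsFiniteMeasure ν]
    (V : Y → EuclideanSpace ℝ (Fin N)) (hV : Measurable V) (hV1 : ∀ᵐ y ∂ν, ‖V y‖ ≤ 1)
    (ε : ℝ) (hε0 : 0 ≤ ε) (hε : ε ≤ 1/2) (q : ℝ) (hq : 1 < q)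
    {g : EuclideanSpace ℝ (Fin N) → ℝ≥0∞} (hg : Measurable g) :
    ∫⁻ x, (∫⁻ y, g (x + (ε * (1 + ‖x‖)) • V y) ∂ν) ^ q
      ≤ ν Set.univ ^ q * 2 ^ N * ∫⁻ x, g x ^ q := by
  have hm : Measurable (fun z : EuclideanSpace ℝ (Fin N) × Y =>
      g (z.1 + (ε * (1 + ‖z.1‖)) • V z.2)) := by
    apply hg.comp
    fun_prop
  calc _ ≤ ∫⁻ x, ν Set.univ ^ (q - 1) * ∫⁻ y, g (x + (ε * (1 + ‖x‖)) • V y) ^ q ∂ν := by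
        apply lintegral_mono
        intro x
        exact jensen_l ν (hm.comp measurable_prodMk_left) q hq
    _ = ν Set.univ ^ (q - 1) * ∫⁻ x, ∫⁻ y, g (x + (ε * (1 + ‖x‖)) • V y) ^ q ∂ν := by
        rw [lintegral_const_mul]
        exact Measurable.lintegral_prod_right' (f := fun z : EuclideanSpace ℝ (Fin N) × Y =>
          g (z.1 + (ε * (1 + ‖z.1‖)) • V z.2) ^ q) (hm.pow_const q)
    _ = ν Set.univ ^ (q - 1) * ∫⁻ y, (∫⁻ x, g (x + (ε * (1 + ‖x‖)) • V y) ^ q) ∂ν := by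
        rw [lintegral_lintegral_swap]
        exact (hm.pow_const q).aemeasurable
    _ ≤ ν Set.univ ^ (q - 1) * ∫⁻ y, (2 ^ N * ∫⁻ x, g x ^ q) ∂ν := by
        refine mul_le_mul_right (lintegral_mono_ae ?_) _
        filter_upwards [hV1] with y hy
        exact lintegral_T_le (T_anti ε hε0 hε (V y) hy) (by fun_prop) (hg.pow_const q)
    _ = _ := by
        rw [lintegral_const]
        have : ν Set.univ ^ q = ν Set.univ ^ (q-1) * ν Set.univ := by
          by_cases h0 : ν Set.univ = 0
          · rw [h0]; simp; linarith
          conv_rhs => rw [← ENNReal.rpow_one (ν Set.univ), ← ENNReal.rpow_mul, one_mul]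
          rw [← ENNReal.rpow_add _ _ h0 (measure_ne_top _ _)]; simp
        rw [this]; ring

theorem pd_contDiff {N : ℕ} {u : EuclideanSpace ℝ (Fin N) → ℝ} (hu : ContDiff ℝ (⊤ : ℕ∞) u)
    (i : Fin N) : ContDiff ℝ (⊤ : ℕ∞) (pd u i) := by
  unfold pd
  have : ContDiff ℝ (⊤ : ℕ∞) (fderiv ℝ u) := hu.fderiv_right (by simp)
  exact this.clm_apply contDiff_const

theorem pd_supp {N : ℕ} {u : EuclideanSpace ℝ (Fin N) → ℝ} (hu : HasCompactSupport u)
    (i : Fin N) : HasCompactSupport (pd u i) := by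
  unfold pd
  exact hu.fderiv_apply ℝ _

theorem smooth_diff {N : ℕ} {u : EuclideanSpace ℝ (Fin N) → ℝ} (hu : ContDiff ℝ (⊤ : ℕ∞) u) :
    Differentiable ℝ u := hu.differentiable (by simp)

theorem fderiv_eq_sum {N : ℕ} (u : EuclideanSpace ℝ (Fin N) → ℝ)
    (x v : EuclideanSpace ℝ (Fin N)) : fderiv ℝ u x v = ∑ j, v j * pd u j x := by
  have hv : v = ∑ j, v j • EuclideanSpace.single j (1 : ℝ) := by
    ext k
    simp [Finset.sum_apply, Pi.single_apply]
  conv_lhs => rw [hv]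
  simp [map_sum, pd]

theorem pd_comm {N : ℕ} {u : EuclideanSpace ℝ (Fin N) → ℝ} (hu : ContDiff ℝ (⊤ : ℕ∞) u)
    (i j : Fin N) (x : EuclideanSpace ℝ (Fin N)) : pd (pd u i) j x = pd (pd u j) i x := by
  have hd : DifferentiableAt ℝ (fderiv ℝ u) x :=
    ((hu.fderiv_right (m := (⊤ : ℕ∞)) (by simp)).differentiable (by simp)) x
  have h : ∀ k l : Fin N, pd (pd u k) l x
      = fderiv ℝ (fderiv ℝ u) x (EuclideanSpace.single l 1) (EuclideanSpace.single k 1) := by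
    intro k l
    unfold pd
    rw [fderiv_clm_apply hd (differentiableAt_const _)]
    simp
  rw [h, h]
  have hs : IsSymmSndFDerivAt ℝ u x :=
    hu.contDiffAt.isSymmSndFDerivAt (by
      simp only [minSmoothness_of_isRCLikeNormedField]; exact WithTop.coe_le_coe.2 (le_top : (2 : ℕ∞) ≤ ⊤))
  exact hs.eq _ _

theorem int_cs {N : ℕ} {f : EuclideanSpace ℝ (Fin N) → ℝ} (hf : Continuous f)
    (hs : HasCompactSupport f) : Integrable f := hf.integrable_of_hasCompactSupport hs

theorem ibp {N : ℕ} {f g : EuclideanSpace ℝ (Fin N) → ℝ} (hf : ContDiff ℝ (⊤ : ℕ∞) f)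
    (hg : ContDiff ℝ (⊤ : ℕ∞) g) (hs : HasCompactSupport g) (i : Fin N) :
    ∫ x, f x * pd g i x = - ∫ x, pd f i x * g x := by
  unfold pd
  apply integral_mul_fderiv_eq_neg_fderiv_mul_of_integrable
  · exact int_cs ((pd_contDiff hf i).continuous.mul hg.continuous) hs.mul_left
  · exact int_cs (hf.continuous.mul (pd_contDiff hg i).continuous) (pd_supp hs i).mul_left
  · exact int_cs (hf.continuous.mul hg.continuous) hs.mul_left
  · intro x _; exact smooth_diff hf x
  · intro x _; exact smooth_diff hg x

theorem pd_affine {N : ℕ} {u : EuclideanSpace ℝ (Fin N) → ℝ} (hu : ContDiff ℝ (⊤ : ℕ∞) u)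
    (x : EuclideanSpace ℝ (Fin N)) (t : ℝ) (i : Fin N) (z : EuclideanSpace ℝ (Fin N)) :
    pd (fun z => u (x + t • z)) i z = t * pd u i (x + t • z) := by
  unfold pd
  have h1 : HasFDerivAt (fun z : EuclideanSpace ℝ (Fin N) => x + t • z)
      (t • ContinuousLinearMap.id ℝ (EuclideanSpace ℝ (Fin N))) z := by
    simpa using ((hasFDerivAt_id z).const_smul t).const_add x
  have h2 := ((smooth_diff hu) (x + t • z)).hasFDerivAt.comp z h1
  have h3 := h2.fderiv
  change fderiv ℝ (u ∘ fun z => x + t • z) z _ = _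
  rw [h3]
  simp

theorem comp_affine {N : ℕ} {u : EuclideanSpace ℝ (Fin N) → ℝ} (hu : ContDiff ℝ (⊤ : ℕ∞) u)
    (x : EuclideanSpace ℝ (Fin N)) (t : ℝ) : ContDiff ℝ (⊤ : ℕ∞) (fun z => u (x + t • z)) := by
  apply hu.comp
  fun_prop

theorem bdd_cs {N : ℕ} {f : EuclideanSpace ℝ (Fin N) → ℝ} (hf : Continuous f)
    (hs : HasCompactSupport f) : ∃ K, 0 ≤ K ∧ ∀ x, |f x| ≤ K := by
  obtain ⟨K, hK⟩ := hs.exists_bound_of_continuous hf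
  exact ⟨K, le_trans (norm_nonneg _) (hK 0), hK⟩

/-- the properties of the averaging kernel -/
structure Ker {N : ℕ} (ρ : EuclideanSpace ℝ (Fin N) → ℝ) : Prop where
  smooth : ContDiff ℝ (⊤ : ℕ∞) ρ
  supp : ∀ z, 1 < ‖z‖ → ρ z = 0
  one : ∫ z, ρ z = 1
  symm : ∀ i j z, pd (fun z => z j * ρ z) i z = pd (fun z => z i * ρ z) j z

theorem Ker.cs {N : ℕ} {ρ : EuclideanSpace ℝ (Fin N) → ℝ} (h : Ker ρ) : HasCompactSupport ρ := by
  apply HasCompactSupport.intro (isCompact_closedBall (0 : EuclideanSpace ℝ (Fin N)) 1)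
  intro x hx
  apply h.supp
  simpa using hx

theorem coord_smooth {N : ℕ} (i : Fin N) :
    ContDiff ℝ (⊤ : ℕ∞) (fun z : EuclideanSpace ℝ (Fin N) => z i) :=
  (EuclideanSpace.proj (𝕜 := ℝ) i).contDiff

theorem pd_coord {N : ℕ} (i j : Fin N) (z : EuclideanSpace ℝ (Fin N)) :
    pd (fun z : EuclideanSpace ℝ (Fin N) => z j) i z = if i = j then 1 else 0 := by
  unfold pd
  have : HasFDerivAt (fun z : EuclideanSpace ℝ (Fin N) => z j)
    (EuclideanSpace.proj (𝕜 := ℝ) j) z := (EuclideanSpace.proj (𝕜 := ℝ) j).hasFDerivAt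
  rw [this.fderiv]
  simp [Pi.single_apply, eq_comm]

theorem pd_mul {N : ℕ} {f g : EuclideanSpace ℝ (Fin N) → ℝ} (hf : ContDiff ℝ (⊤ : ℕ∞) f)
    (hg : ContDiff ℝ (⊤ : ℕ∞) g) (i : Fin N) (z : EuclideanSpace ℝ (Fin N)) :
    pd (fun z => f z * g z) i z = f z * pd g i z + pd f i z * g z := by
  unfold pd
  rw [fderiv_fun_mul (smooth_diff hf z) (smooth_diff hg z)]
  simp [mul_comm]

theorem pd_scalar_comp {N : ℕ} {φ : ℝ → ℝ} {φ' : ℝ} {f : EuclideanSpace ℝ (Fin N) → ℝ}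
    (hf : ContDiff ℝ (⊤ : ℕ∞) f) (i : Fin N) (z : EuclideanSpace ℝ (Fin N))
    (hφ : HasDerivAt φ φ' (f z)) :
    pd (fun z => φ (f z)) i z = φ' * pd f i z := by
  unfold pd
  have := (hφ.comp_hasFDerivAt z (smooth_diff hf z).hasFDerivAt).fderiv
  change fderiv ℝ (φ ∘ f) z _ = _
  rw [this]; simp

theorem nsq_smooth {N : ℕ} :
    ContDiff ℝ (⊤ : ℕ∞) (fun z : EuclideanSpace ℝ (Fin N) => ‖z‖ ^ 2) := contDiff_norm_sq ℝ

theorem pd_nsq {N : ℕ} (i : Fin N) (z : EuclideanSpace ℝ (Fin N)) :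
    pd (fun z : EuclideanSpace ℝ (Fin N) => ‖z‖ ^ 2) i z = 2 * z i := by
  unfold pd
  rw [fderiv_norm_sq_apply]
  simp [EuclideanSpace.inner_single_right]

theorem exists_ker (N : ℕ) : ∃ ρ : EuclideanSpace ℝ (Fin N) → ℝ, Ker ρ := by
  let φ : ℝ → ℝ := fun s => expNegInvGlue (1 - s)
  have hφ : ContDiff ℝ (⊤ : ℕ∞) φ := expNegInvGlue.contDiff.comp (by fun_prop)
  let ρ₀ : EuclideanSpace ℝ (Fin N) → ℝ := fun z => φ (‖z‖ ^ 2)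
  have h0 : ContDiff ℝ (⊤ : ℕ∞) ρ₀ := hφ.comp nsq_smooth
  have hsupp : ∀ z, 1 < ‖z‖ → ρ₀ z = 0 := by
    intro z hz
    apply expNegInvGlue.zero_of_nonpos
    nlinarith
  have hcs : HasCompactSupport ρ₀ := by
    apply HasCompactSupport.intro (isCompact_closedBall (0 : EuclideanSpace ℝ (Fin N)) 1)
    intro x hx
    apply hsupp
    simpa using hx
  have hpos : 0 < ∫ z, ρ₀ z := by
    apply h0.continuous.integral_pos_of_hasCompactSupport_nonneg_nonzero hcs
      (fun z => expNegInvGlue.nonneg _) (x := 0)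
    apply ne_of_gt
    apply expNegInvGlue.pos_of_pos
    simp
  refine ⟨fun z => (∫ z, ρ₀ z)⁻¹ * ρ₀ z, ?_, ?_, ?_, ?_⟩
  · exact contDiff_const.mul h0
  · intro z hz; simp [hsupp z hz]
  · rw [integral_const_mul, inv_mul_cancel₀ hpos.ne']
  · intro i j z
    have h1 : ContDiff ℝ (⊤ : ℕ∞) (fun z => (∫ z, ρ₀ z)⁻¹ * ρ₀ z) := contDiff_const.mul h0
    rw [pd_mul (coord_smooth j) h1, pd_mul (coord_smooth i) h1, pd_coord, pd_coord]
    have h2 : ∀ k, pd (fun z => (∫ z, ρ₀ z)⁻¹ * ρ₀ z) k z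
        = ((∫ z, ρ₀ z)⁻¹ * deriv φ (‖z‖^2)) * (2 * z k) := by
      intro k
      rw [← pd_nsq]
      exact pd_scalar_comp (φ := fun s => (∫ z, ρ₀ z)⁻¹ * φ s) nsq_smooth k z
        (((hφ.differentiable (by simp)) _).hasDerivAt.const_mul _)
    rw [h2, h2]
    simp only [eq_comm (a := i)]
    ring

theorem swap_ibp {N : ℕ} {ρ : EuclideanSpace ℝ (Fin N) → ℝ} (h : Ker ρ)
    {u : EuclideanSpace ℝ (Fin N) → ℝ} (hu : ContDiff ℝ (⊤ : ℕ∞) u)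
    (x : EuclideanSpace ℝ (Fin N)) (t : ℝ) (ht : t ≠ 0) (i j : Fin N) :
    ∫ z, pd (pd u i) j (x + t • z) * (z j * ρ z) = ∫ z, pd (pd u j) j (x + t • z) * (z i * ρ z) := by
  have hk : ∀ k, ContDiff ℝ (⊤ : ℕ∞) (fun z : EuclideanSpace ℝ (Fin N) => z k * ρ z) :=
    fun k => (coord_smooth k).mul h.smooth
  have hc : ∀ k, HasCompactSupport (fun z : EuclideanSpace ℝ (Fin N) => z k * ρ z) :=
    fun k => h.cs.mul_left
  have hj := pd_contDiff hu j
  have e1 := ibp (comp_affine hj x t) (hk j) (hc j) i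
  have e2 := ibp (comp_affine hj x t) (hk i) (hc i) j
  simp only [pd_affine hj] at e1 e2
  simp only [h.symm i j] at e1
  rw [e1] at e2
  have e3 := neg_injective e2
  simp only [mul_assoc] at e3
  rw [integral_const_mul, integral_const_mul] at e3
  have e4 := mul_left_cancel₀ ht e3
  simp only [pd_comm hu i j]
  exact e4

theorem lap_cont {N : ℕ} {u : EuclideanSpace ℝ (Fin N) → ℝ} (hu : ContDiff ℝ (⊤ : ℕ∞) u) :
    Continuous (lap u) := by
  unfold lap
  exact continuous_finsetSum _ fun i _ => (pd_contDiff (pd_contDiff hu i) i).continuous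

theorem lap_supp {N : ℕ} {u : EuclideanSpace ℝ (Fin N) → ℝ} (hu : HasCompactSupport u) :
    HasCompactSupport (lap u) := by
  apply HasCompactSupport.intro hu
  intro x hx
  unfold lap
  apply Finset.sum_eq_zero
  intro i _
  have h1 : tsupport (pd (pd u i) i) ⊆ tsupport u :=
    (tsupport_fderiv_apply_subset ℝ _).trans (tsupport_fderiv_apply_subset ℝ _)
  exact image_eq_zero_of_notMem_tsupport fun h => hx (h1 h)

theorem rep {N : ℕ} {ρ : EuclideanSpace ℝ (Fin N) → ℝ} (h : Ker ρ)
    {u : EuclideanSpace ℝ (Fin N) → ℝ} (hu : ContDiff ℝ (⊤ : ℕ∞) u) (hs : HasCompactSupport u)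
    (x : EuclideanSpace ℝ (Fin N)) (r : ℝ) (hr : 0 < r) (i : Fin N) :
    pd u i x = - (r⁻¹ * ∫ z, u (x + r • z) * pd ρ i z)
      - ∫ t in (0:ℝ)..1, r * ∫ z, lap u (x + (r * t) • z) * (z i * ρ z) := by
  have hui := pd_contDiff hu i
  have hρc := h.smooth.continuous
  -- the derivative in t
  let F' : ℝ → EuclideanSpace ℝ (Fin N) → ℝ := fun t z =>
    r * (∑ j, z j * pd (pd u i) j (x + (r * t) • z)) * ρ z
  have hF'c : ∀ t, Continuous (F' t) := by
    intro t
    refine (continuous_const.mul (continuous_finsetSum _ fun j _ => ?_)).mul hρc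
    exact (coord_smooth j).continuous.mul
      ((pd_contDiff hui j).continuous.comp (by fun_prop))
  have hbd : ∃ K, 0 ≤ K ∧ ∀ j, ∀ y, |pd (pd u i) j y| ≤ K := by
    choose K hK0 hK using fun j => bdd_cs (pd_contDiff hui j).continuous (pd_supp (pd_supp hs i) j)
    refine ⟨∑ j, K j, Finset.sum_nonneg fun j _ => hK0 j, fun j y => (hK j y).trans ?_⟩
    exact Finset.single_le_sum (fun j _ => hK0 j) (Finset.mem_univ j)
  obtain ⟨K, hK0, hK⟩ := hbd
  have hder : ∀ t, HasDerivAt (fun t => ∫ z, pd u i (x + (r * t) • z) * ρ z) (∫ z, F' t z) t := by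
    intro t
    refine (hasDerivAt_integral_of_dominated_loc_of_deriv_le
      (bound := fun z => r * (∑ j : Fin N, |z j| * K) * |ρ z|) Filter.univ_mem ?_ ?_ ?_ ?_ ?_ ?_).2
    · refine Filter.Eventually.of_forall fun t => Continuous.aestronglyMeasurable ?_
      exact (hui.continuous.comp (by fun_prop)).mul hρc
    · exact int_cs ((hui.continuous.comp (by fun_prop)).mul hρc) h.cs.mul_left
    · exact (hF'c t).aestronglyMeasurable
    · refine Filter.Eventually.of_forall fun z t _ => ?_
      simp only [F', Real.norm_eq_abs, abs_mul, abs_of_pos hr]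
      gcongr
      refine (Finset.abs_sum_le_sum_abs _ _).trans ?_
      apply Finset.sum_le_sum
      intro j _
      rw [abs_mul]
      gcongr
      exact hK j _
    · apply int_cs
      · refine (continuous_const.mul (continuous_finsetSum _ fun j _ => ?_)).mul hρc.abs
        exact (coord_smooth j).continuous.abs.mul continuous_const
      · exact HasCompactSupport.mul_left (h.cs.comp_left abs_zero)
    · refine Filter.Eventually.of_forall fun z t _ => ?_
      apply HasDerivAt.mul_const
      have h1 : HasDerivAt (fun t : ℝ => x + (r * t) • z) (r • z) t := by
        have := (((hasDerivAt_id t).const_mul r).smul_const z).const_add x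
        simpa using this
      have h2 := (smooth_diff hui (x + (r * t) • z)).hasFDerivAt.comp_hasDerivAt t h1
      rw [map_smul, fderiv_eq_sum, smul_eq_mul] at h2
      exact h2
  have hdv : ∀ t, t ≠ 0 → ∫ z, F' t z = r * ∫ z, lap u (x + (r * t) • z) * (z i * ρ z) := by
    intro t ht
    have e1 : ∀ z, F' t z = r * ∑ j, pd (pd u i) j (x + (r * t) • z) * (z j * ρ z) := by
      intro z
      simp only [F', mul_assoc, Finset.sum_mul]
      congr 1
      apply Finset.sum_congr rfl
      intro j _
      ring
    simp only [e1, lap, Finset.sum_mul]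
    rw [integral_const_mul, integral_finsetSum, integral_finsetSum]
    · congr 1
      apply Finset.sum_congr rfl
      intro j _
      exact swap_ibp h hu x (r * t) (mul_ne_zero hr.ne' ht) i j
    · intro j _
      exact int_cs (((pd_contDiff (pd_contDiff hu j) j).continuous.comp (by fun_prop)).mul
        ((coord_smooth i).continuous.mul hρc)) (h.cs.mul_left.mul_left)
    · intro j _
      exact int_cs (((pd_contDiff hui j).continuous.comp (by fun_prop)).mul
        ((coord_smooth j).continuous.mul hρc)) (h.cs.mul_left.mul_left)
  have hcont : Continuous fun t : ℝ => r * ∫ z, lap u (x + (r * t) • z) * (z i * ρ z) := by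
    obtain ⟨L, hL0, hL⟩ := bdd_cs (lap_cont hu) (lap_supp hs)
    have hzc : Continuous fun z : EuclideanSpace ℝ (Fin N) => z i * ρ z :=
      (coord_smooth i).continuous.mul hρc
    refine continuous_const.mul (continuous_of_dominated
      (bound := fun z => L * |z i * ρ z|) ?_ ?_ ?_ ?_)
    · intro t
      exact (((lap_cont hu).comp (by fun_prop)).mul hzc).aestronglyMeasurable
    · intro t
      refine Filter.Eventually.of_forall fun z => ?_
      rw [norm_mul]
      exact mul_le_mul_of_nonneg_right (hL _) (abs_nonneg _)
    · exact int_cs (continuous_const.mul hzc.abs)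
        (HasCompactSupport.mul_left ((h.cs.mul_left (f := fun z : EuclideanSpace ℝ (Fin N) => z i)).comp_left abs_zero))
    · refine Filter.Eventually.of_forall fun z => ?_
      exact ((lap_cont hu).comp (by fun_prop)).mul continuous_const
  have hftc := intervalIntegral.integral_eq_sub_of_hasDerivAt_of_le (a := (0:ℝ)) (b := 1)
    (f := fun t => ∫ z, pd u i (x + (r * t) • z) * ρ z)
    (f' := fun t => r * ∫ z, lap u (x + (r * t) • z) * (z i * ρ z)) zero_le_one
    (fun t _ => (hder t).continuousAt.continuousWithinAt)
    (fun t ht => by rw [← hdv t ht.1.ne']; exact hder t)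
    (hcont.intervalIntegrable _ _)
  rw [hftc]
  simp only [mul_one, mul_zero, zero_smul, add_zero]
  rw [integral_const_mul, h.one, mul_one]
  have e := ibp (comp_affine hu x r) h.smooth h.cs i
  simp only [pd_affine hu] at e
  rw [e]
  simp only [mul_assoc]
  rw [integral_const_mul]
  field_simp
  ring

theorem ptw (N : ℕ) : ∃ M : ℝ, 0 < M ∧ ∀ u : EuclideanSpace ℝ (Fin N) → ℝ,
    ContDiff ℝ (⊤ : ℕ∞) u → HasCompactSupport u → ∀ x, ∀ r : ℝ, 0 < r → ∀ i,
    ‖pd u i x‖ₑ ≤ ENNReal.ofReal (M / r) *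
        ∫⁻ z, ‖u (x + r • z)‖ₑ ∂(volume.restrict (closedBall 0 1))
      + ENNReal.ofReal (M * r) * ∫⁻ y : ℝ × EuclideanSpace ℝ (Fin N),
        ‖lap u (x + r • (y.1 • y.2))‖ₑ
          ∂((volume.restrict (Set.Ioc 0 1)).prod (volume.restrict (closedBall 0 1))) := by
  obtain ⟨ρ, h⟩ := exists_ker N
  have hb : ∃ M : ℝ, 0 < M ∧ (∀ i z, |pd ρ i z| ≤ M) ∧ ∀ (i : Fin N) z, |z i * ρ z| ≤ M := by
    choose K hK0 hK using fun j => bdd_cs (pd_contDiff h.smooth j).continuous (pd_supp h.cs j)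
    choose L hL0 hL using fun j : Fin N => bdd_cs
      ((coord_smooth j).continuous.mul h.smooth.continuous) h.cs.mul_left
    refine ⟨1 + ∑ j, K j + ∑ j, L j, ?_, ?_, ?_⟩
    · have := Finset.sum_nonneg fun j (_ : j ∈ Finset.univ) => hK0 j
      have := Finset.sum_nonneg fun j (_ : j ∈ Finset.univ) => hL0 j
      linarith
    · intro i z
      have := Finset.sum_nonneg fun j (_ : j ∈ Finset.univ) => hL0 j
      have := Finset.single_le_sum (fun j _ => hK0 j) (Finset.mem_univ i)
      linarith [hK i z]
    · intro i z
      have := Finset.sum_nonneg fun j (_ : j ∈ Finset.univ) => hK0 j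
      have := Finset.single_le_sum (fun j _ => hL0 j) (Finset.mem_univ i)
      have h3 := hL i z
      simp only [Pi.mul_apply] at h3
      linarith
  obtain ⟨M, hM, hM1, hM2⟩ := hb
  refine ⟨M, hM, ?_⟩
  have hz1 : ∀ i (z : EuclideanSpace ℝ (Fin N)), z ∉ closedBall (0 : EuclideanSpace ℝ (Fin N)) 1 →
      pd ρ i z = 0 := by
    intro i z hz
    have h1 : tsupport (pd ρ i) ⊆ tsupport ρ := tsupport_fderiv_apply_subset ℝ _
    have h2 : tsupport ρ ⊆ closedBall (0 : EuclideanSpace ℝ (Fin N)) 1 := by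
      apply closure_minimal _ isClosed_closedBall
      intro y hy
      by_contra hy'
      exact hy (h.supp y (by simpa using hy'))
    exact image_eq_zero_of_notMem_tsupport fun h' => hz (h2 (h1 h'))
  have hz2 : ∀ (i : Fin N) (z : EuclideanSpace ℝ (Fin N)),
      z ∉ closedBall (0 : EuclideanSpace ℝ (Fin N)) 1 → z i * ρ z = 0 := by
    intro i z hz
    rw [h.supp z (by simpa using hz), mul_zero]
  -- generic bound
  have gen : ∀ (f k : EuclideanSpace ℝ (Fin N) → ℝ), (∀ z, |k z| ≤ M) →
      (∀ z, z ∉ closedBall (0 : EuclideanSpace ℝ (Fin N)) 1 → k z = 0) →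
      ‖∫ z, f z * k z‖ₑ ≤ ENNReal.ofReal M *
        ∫⁻ z, ‖f z‖ₑ ∂(volume.restrict (closedBall 0 1)) := by
    intro f k hk hk0
    have : ∫ z, f z * k z = ∫ z in closedBall 0 1, f z * k z := by
      rw [setIntegral_eq_integral_of_forall_compl_eq_zero]
      intro z hz; rw [hk0 z hz, mul_zero]
    rw [this]
    refine (enorm_integral_le_lintegral_enorm _).trans ?_
    rw [← lintegral_const_mul' _ _ ENNReal.ofReal_ne_top]
    apply lintegral_mono
    intro z
    simp only [enorm_mul]
    rw [mul_comm]
    gcongr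
    rw [Real.enorm_eq_ofReal_abs]
    exact ENNReal.ofReal_le_ofReal (hk z)
  intro u hu hs x r hr i
  rw [rep h hu hs x r hr i]
  refine (enorm_sub_le).trans (add_le_add ?_ ?_)
  · rw [enorm_neg, enorm_mul, div_eq_inv_mul, ENNReal.ofReal_mul (by positivity), mul_assoc,
      Real.enorm_eq_ofReal (by positivity)]
    gcongr
    exact gen _ _ (hM1 i) (hz1 i)
  · rw [intervalIntegral.integral_of_le zero_le_one]
    refine (enorm_integral_le_lintegral_enorm _).trans ?_
    have hm : Measurable fun y : ℝ × EuclideanSpace ℝ (Fin N) =>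
        ‖lap u (x + r • (y.1 • y.2))‖ₑ :=
      (Continuous.enorm ((lap_cont hu).comp (by fun_prop))).measurable
    rw [lintegral_prod _ hm.aemeasurable, ← lintegral_const_mul' _ _ ENNReal.ofReal_ne_top]
    apply lintegral_mono
    intro t
    simp only [enorm_mul]
    rw [mul_comm M, ENNReal.ofReal_mul hr.le, mul_assoc, Real.enorm_eq_ofReal hr.le]
    gcongr
    simp only [smul_smul]
    exact gen _ _ (hM2 i) (hz2 i)

theorem weight_cmp {N : ℕ} (ε : ℝ) (hε0 : 0 ≤ ε) (hε : ε ≤ 1/2) (γ : ℝ) (hγ : 0 ≤ γ)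
    (x z : EuclideanSpace ℝ (Fin N)) (hz : ‖z‖ ≤ 1) :
    (1 + ‖x‖) ^ γ ≤ 2 ^ γ * (1 + ‖x + (ε * (1 + ‖x‖)) • z‖) ^ γ := by
  rw [← Real.mul_rpow (by norm_num) (by positivity)]
  apply Real.rpow_le_rpow (by positivity) _ hγ
  have h1 : ‖(ε * (1 + ‖x‖)) • z‖ ≤ 1/2 * (1 + ‖x‖) := by
    rw [norm_smul, Real.norm_of_nonneg (by positivity)]
    calc ε * (1 + ‖x‖) * ‖z‖ ≤ 1/2 * (1 + ‖x‖) * 1 := by gcongr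
      _ = _ := by ring
  have h2 := norm_sub_le (x + (ε * (1 + ‖x‖)) • z) ((ε * (1 + ‖x‖)) • z)
  rw [add_sub_cancel_right] at h2
  linarith

theorem avg_w {N : ℕ} {Y : Type*} [MeasurableSpace Y] (ν : Measure Y) [IsFiniteMeasure ν]
    (V : Y → EuclideanSpace ℝ (Fin N)) (hV : Measurable V) (hV1 : ∀ᵐ y ∂ν, ‖V y‖ ≤ 1)
    (p : ℝ≥0∞) (hp1 : 1 < p) (hp2 : p ≠ ⊤) (γ : ℝ) (hγ : 0 ≤ γ) :
    ∃ A : ℝ≥0, ∀ ε : ℝ, 0 ≤ ε → ε ≤ 1/2 → ∀ w : EuclideanSpace ℝ (Fin N) → ℝ, Continuous w →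
      (∫⁻ x, (ENNReal.ofReal ((1 + ‖x‖) ^ γ) *
        ∫⁻ y, ‖w (x + (ε * (1 + ‖x‖)) • V y)‖ₑ ∂ν) ^ p.toReal) ^ (1 / p.toReal)
        ≤ A * eLpNorm (fun x => (1 + ‖x‖) ^ γ * w x) p volume := by
  have hq : 1 < p.toReal := by
    rw [← ENNReal.toReal_one]; exact (ENNReal.toReal_lt_toReal (by simp) hp2).2 hp1
  have hq0 : 0 < p.toReal := by linarith
  have hfin : (ENNReal.ofReal (2 ^ γ) ^ p.toReal * (ν Set.univ ^ p.toReal * 2 ^ N)) ^ (1 / p.toReal)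
      ≠ ⊤ := by
    apply ENNReal.rpow_ne_top_of_nonneg (by positivity)
    refine ENNReal.mul_ne_top (ENNReal.rpow_ne_top_of_nonneg hq0.le ENNReal.ofReal_ne_top)
      (ENNReal.mul_ne_top (ENNReal.rpow_ne_top_of_nonneg hq0.le (measure_ne_top _ _)) (by simp))
  refine ⟨ENNReal.toNNReal ((ENNReal.ofReal (2 ^ γ) ^ p.toReal *
    (ν Set.univ ^ p.toReal * 2 ^ N)) ^ (1 / p.toReal)), ?_⟩
  intro ε hε0 hε w hw
  rw [ENNReal.coe_toNNReal hfin]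
  rw [eLpNorm_eq_lintegral_rpow_enorm_toReal (by positivity) hp2]
  rw [← ENNReal.mul_rpow_of_nonneg _ _ (by positivity)]
  apply ENNReal.rpow_le_rpow _ (by positivity)
  have hgm : Measurable fun x : EuclideanSpace ℝ (Fin N) => ‖(1 + ‖x‖) ^ γ * w x‖ₑ := by
    have : Measurable fun x : EuclideanSpace ℝ (Fin N) => (1 + ‖x‖) ^ γ := by fun_prop
    exact (this.mul hw.measurable).enorm
  have key := avg_le ν V hV hV1 ε hε0 hε p.toReal hq hgm
  rw [mul_assoc]
  refine le_trans ?_ (mul_le_mul_right key _)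
  rw [← lintegral_const_mul' _ _ (ENNReal.rpow_ne_top_of_nonneg hq0.le ENNReal.ofReal_ne_top)]
  apply lintegral_mono
  intro x
  simp only []
  rw [← ENNReal.mul_rpow_of_nonneg _ _ hq0.le]
  apply ENNReal.rpow_le_rpow _ hq0.le
  rw [← lintegral_const_mul' _ _ ENNReal.ofReal_ne_top, ← lintegral_const_mul' _ _ ENNReal.ofReal_ne_top]
  apply lintegral_mono_ae
  filter_upwards [hV1] with y hy
  rw [enorm_mul, ← mul_assoc]
  gcongr
  rw [Real.enorm_eq_ofReal (by positivity), ← ENNReal.ofReal_mul (by positivity)]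
  exact ENNReal.ofReal_le_ofReal (weight_cmp ε hε0 hε γ hγ x (V y) hy)

theorem interp (N : ℕ) (α : ℝ) (hα : 2 < α) (p : ℝ≥0∞) (hp1 : 1 < p) (hp2 : p ≠ ⊤) :
    ∃ M : ℝ, 0 < M ∧ ∀ u : EuclideanSpace ℝ (Fin N) → ℝ,
    ContDiff ℝ (⊤ : ℕ∞) u → HasCompactSupport u → ∀ ε : ℝ, 0 < ε → ε ≤ 1/2 → ∀ i,
    eLpNorm (fun x => (1 + ‖x‖) ^ (α - 1) * pd u i x) p volume ≤
      ENNReal.ofReal (M / ε) * eLpNorm (fun x => (1 + ‖x‖) ^ (α - 2) * u x) p volume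
      + ENNReal.ofReal (M * ε) * eLpNorm (fun x => (1 + ‖x‖) ^ α * lap u x) p volume := by
  have hq : 1 < p.toReal := by
    rw [← ENNReal.toReal_one]; exact (ENNReal.toReal_lt_toReal (by simp) hp2).2 hp1
  have hq0 : 0 < p.toReal := by linarith
  obtain ⟨M, hM, hMb⟩ := ptw N
  set ν₁ : Measure (EuclideanSpace ℝ (Fin N)) := volume.restrict (closedBall 0 1) with hν₁
  set ν₂ : Measure (ℝ × EuclideanSpace ℝ (Fin N)) :=
    (volume.restrict (Set.Ioc 0 1)).prod (volume.restrict (closedBall 0 1)) with hν₂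
  have fin1 : IsFiniteMeasure ν₁ := ⟨by
    rw [hν₁, Measure.restrict_apply_univ]; exact measure_closedBall_lt_top⟩
  have fin2 : IsFiniteMeasure ν₂ := by rw [hν₂]; infer_instance
  have ae1 : ∀ᵐ y ∂ν₁, ‖id y‖ ≤ 1 := by
    filter_upwards [ae_restrict_mem measurableSet_closedBall] with y hy
    simpa using hy
  have ae2 : ∀ᵐ y ∂ν₂, ‖y.1 • y.2‖ ≤ 1 := by
    rw [hν₂, Measure.prod_restrict]
    filter_upwards [ae_restrict_mem (measurableSet_Ioc.prod measurableSet_closedBall)] with y hy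
    obtain ⟨⟨h1, h2⟩, h3⟩ := hy
    rw [norm_smul, Real.norm_of_nonneg h1.le]
    simp only [mem_closedBall, dist_zero_right] at h3
    nlinarith [norm_nonneg y.2]
  obtain ⟨A₁, hA₁⟩ := avg_w ν₁ id measurable_id ae1 p hp1 hp2 (α - 2) (by linarith)
  obtain ⟨A₂, hA₂⟩ := avg_w ν₂ (fun y => y.1 • y.2) (by fun_prop) ae2 p hp1 hp2 α (by linarith)
  refine ⟨M * (1 + A₁ + A₂), by positivity, ?_⟩
  intro u hu hs ε hε0 hε i
  set G : EuclideanSpace ℝ (Fin N) → ℝ≥0∞ := fun x => ENNReal.ofReal ((1 + ‖x‖) ^ (α - 2)) *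
        ∫⁻ y, ‖u (x + (ε * (1 + ‖x‖)) • id y)‖ₑ ∂ν₁ with hG
  set H : EuclideanSpace ℝ (Fin N) → ℝ≥0∞ := fun x => ENNReal.ofReal ((1 + ‖x‖) ^ α) *
        ∫⁻ y, ‖lap u (x + (ε * (1 + ‖x‖)) • (y.1 • y.2))‖ₑ ∂ν₂ with hH
  have hGm : Measurable G := by
    apply Measurable.mul (by fun_prop)
    apply Measurable.lintegral_prod_right' (f := fun z : EuclideanSpace ℝ (Fin N) ×
      EuclideanSpace ℝ (Fin N) => ‖u (z.1 + (ε * (1 + ‖z.1‖)) • id z.2)‖ₑ)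
    exact (Continuous.enorm (hu.continuous.comp (by fun_prop))).measurable
  have hHm : Measurable H := by
    apply Measurable.mul (by fun_prop)
    apply Measurable.lintegral_prod_right' (f := fun z : EuclideanSpace ℝ (Fin N) ×
      (ℝ × EuclideanSpace ℝ (Fin N)) => ‖lap u (z.1 + (ε * (1 + ‖z.1‖)) • (z.2.1 • z.2.2))‖ₑ)
    exact (Continuous.enorm ((lap_cont hu).comp (by fun_prop))).measurable
  have cst : ∀ (k : ℝ) (g : EuclideanSpace ℝ (Fin N) → ℝ≥0∞),
      (∫⁻ x, (ENNReal.ofReal k * g x) ^ p.toReal) ^ (1 / p.toReal)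
        = ENNReal.ofReal k * (∫⁻ x, g x ^ p.toReal) ^ (1 / p.toReal) := by
    intro k g
    simp only [ENNReal.mul_rpow_of_nonneg _ _ hq0.le]
    rw [lintegral_const_mul' _ _ (ENNReal.rpow_ne_top_of_nonneg hq0.le ENNReal.ofReal_ne_top),
      ENNReal.mul_rpow_of_nonneg _ _ (by positivity), ← ENNReal.rpow_mul,
      mul_one_div_cancel hq0.ne', ENNReal.rpow_one]
  have pt : ∀ x, ‖(1 + ‖x‖) ^ (α - 1) * pd u i x‖ₑ ≤
      ENNReal.ofReal (M / ε) * G x + ENNReal.ofReal (M * ε) * H x := by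
    intro x
    have hx : 0 < 1 + ‖x‖ := by positivity
    rw [enorm_mul, Real.enorm_eq_ofReal (by positivity)]
    refine (mul_le_mul_right (hMb u hu hs x (ε * (1 + ‖x‖)) (by positivity) i) _).trans ?_
    rw [mul_add, ← mul_assoc, ← mul_assoc, ← ENNReal.ofReal_mul (by positivity),
      ← ENNReal.ofReal_mul (by positivity), hG, hH]
    simp only [id]
    rw [← mul_assoc (ENNReal.ofReal (M / ε)), ← mul_assoc (ENNReal.ofReal (M * ε)), ← ENNReal.ofReal_mul (by positivity),
      ← ENNReal.ofReal_mul (by positivity)]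
    have e1 : (1 + ‖x‖) ^ (α - 1) = (1 + ‖x‖) ^ (α - 2) * (1 + ‖x‖) := by
      rw [← Real.rpow_add_one hx.ne']; congr 1; ring
    have e2 : (1 + ‖x‖) ^ α = (1 + ‖x‖) ^ (α - 1) * (1 + ‖x‖) := by
      rw [← Real.rpow_add_one hx.ne']; congr 1; ring
    apply le_of_eq
    congr 3
    · rw [e1]; field_simp
    · rw [e2]; ring
  rw [eLpNorm_eq_lintegral_rpow_enorm_toReal (by positivity) hp2]
  calc _ ≤ (∫⁻ x, ((fun x => ENNReal.ofReal (M / ε) * G x) + fun x => ENNReal.ofReal (M * ε) * H x) x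
          ^ p.toReal) ^ (1 / p.toReal) := by
        apply ENNReal.rpow_le_rpow _ (by positivity)
        apply lintegral_mono
        intro x
        exact ENNReal.rpow_le_rpow (pt x) hq0.le
    _ ≤ _ := ENNReal.lintegral_Lp_add_le (hGm.const_mul _).aemeasurable
        (hHm.const_mul _).aemeasurable hq.le
    _ ≤ _ := by
        rw [cst, cst]
        refine add_le_add ?_ ?_
        · refine (mul_le_mul_right (hA₁ ε hε0.le hε u hu.continuous) _).trans ?_
          rw [← mul_assoc]
          gcongr
          rw [← ENNReal.ofReal_coe_nnreal, ← ENNReal.ofReal_mul (by positivity)]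
          apply ENNReal.ofReal_le_ofReal
          rw [div_mul_eq_mul_div]
          gcongr
          linarith [A₂.coe_nonneg]
        · refine (mul_le_mul_right (hA₂ ε hε0.le hε _ (lap_cont hu)) _).trans ?_
          rw [← mul_assoc]
          gcongr
          rw [← ENNReal.ofReal_coe_nnreal, ← ENNReal.ofReal_mul (by positivity)]
          apply ENNReal.ofReal_le_ofReal
          rw [mul_right_comm]
          gcongr
          linarith [A₁.coe_nonneg]

theorem young_s (q : ℝ) (hq : 1 < q) (ε : ℝ) (hε : 0 < ε) :
    ∃ C : ℝ, 0 ≤ C ∧ ∀ a b : ℝ, 0 ≤ a → 0 ≤ b → a * b ^ (q - 1) ≤ ε * b ^ q + C * a ^ q := by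
  refine ⟨(1 / ε) ^ (q - 1), by positivity, ?_⟩
  intro a b ha hb
  have key : ∀ y : ℝ, 0 ≤ y → y ^ q = y * y ^ (q - 1) := by
    intro y hy
    rcases hy.eq_or_lt with rfl | hy
    · rw [Real.zero_rpow (by linarith)]; simp
    · conv_rhs => rw [mul_comm, ← Real.rpow_add_one hy.ne']
      congr 1; ring
  rcases le_total a (ε * b) with h | h
  · have : a * b ^ (q - 1) ≤ (ε * b) * b ^ (q - 1) := by gcongr
    rw [key b hb]
    have h2 : 0 ≤ (1 / ε) ^ (q - 1) * a ^ q := by positivity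
    nlinarith
  · have h1 : b ≤ 1 / ε * a := by
      rw [one_div, ← div_eq_inv_mul, le_div_iff₀ hε]; linarith
    have : a * b ^ (q - 1) ≤ a * (1 / ε * a) ^ (q - 1) := by
      gcongr
    rw [Real.mul_rpow (by positivity) ha] at this
    rw [key a ha]
    have h2 : 0 ≤ ε * b ^ q := by positivity
    nlinarith

theorem lower_s (P e : ℝ) (hP : 0 ≤ P) (he : 0 < e) (ε : ℝ) (hε : 0 < ε) :
    ∃ C : ℝ, 0 ≤ C ∧ ∀ J : ℝ, 1 ≤ J → J ^ (P - e) ≤ ε * J ^ P + C := by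
  refine ⟨((1 / ε) ^ (1 / e)) ^ P, by positivity, ?_⟩
  intro J hJ
  have hJ0 : 0 < J := by linarith
  have hs : J ^ P = J ^ (P - e) * J ^ e := by rw [← Real.rpow_add hJ0]; congr 1; ring
  have hp1 : 0 < J ^ (P - e) := by positivity
  have hp2 : 0 ≤ ((1 / ε) ^ (1 / e)) ^ P := by positivity
  rcases le_total (1 / ε) (J ^ e) with h | h
  · have : 1 ≤ ε * J ^ e := by
      rw [div_le_iff₀ hε] at h; linarith
    rw [hs]; nlinarith
  · have h1 : J ≤ (1 / ε) ^ (1 / e) := by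
      have := Real.rpow_le_rpow (by positivity) h (by positivity : 0 ≤ 1 / e)
      rwa [← Real.rpow_mul hJ0.le, mul_one_div_cancel he.ne', Real.rpow_one] at this
    have h2 : J ^ (P - e) ≤ J ^ P := Real.rpow_le_rpow_of_exponent_le hJ (by linarith)
    have h3 := Real.rpow_le_rpow hJ0.le h1 hP
    have h4 : 0 ≤ ε * J ^ P := by positivity
    linarith

/-- regularised power -/
noncomputable def Gd (q δ t : ℝ) : ℝ := ((t ^ 2 + δ) ^ (q / 2) - δ ^ (q / 2)) / q

theorem Gd_deriv (q δ t : ℝ) (hq : 1 < q) (hδ : 0 < δ) :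
    HasDerivAt (Gd q δ) (t * (t ^ 2 + δ) ^ (q / 2 - 1)) t := by
  have h0 : t ^ 2 + δ ≠ 0 := by positivity
  have h1 : HasDerivAt (fun t : ℝ => t ^ 2 + δ) (2 * t) t := by
    simpa using (hasDerivAt_pow 2 t).add_const δ
  have h2 := ((h1.rpow_const (p := q / 2) (Or.inl h0)).sub_const (δ ^ (q / 2))).div_const q
  refine h2.congr_deriv ?_
  field_simp

theorem Gd_deriv2 (q δ t : ℝ) (hδ : 0 < δ) :
    HasDerivAt (fun t => t * (t ^ 2 + δ) ^ (q / 2 - 1))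
      ((t ^ 2 + δ) ^ (q / 2 - 1) * (1 + (q - 2) * t ^ 2 / (t ^ 2 + δ))) t := by
  have h0 : t ^ 2 + δ ≠ 0 := by positivity
  have h1 : HasDerivAt (fun t : ℝ => t ^ 2 + δ) (2 * t) t := by
    simpa using (hasDerivAt_pow 2 t).add_const δ
  have h2 := (hasDerivAt_id t).mul (h1.rpow_const (p := q / 2 - 1) (Or.inl h0))
  refine h2.congr_deriv ?_
  rw [Real.rpow_sub_one h0 (q / 2 - 1)]
  simp only [id]
  field_simp

theorem Gd_second_lower (q δ t : ℝ) (hδ : 0 < δ) :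
    min 1 (q - 1) ≤ 1 + (q - 2) * t ^ 2 / (t ^ 2 + δ) := by
  have h0 : 0 < t ^ 2 + δ := by positivity
  have : 1 + (q - 2) * t ^ 2 / (t ^ 2 + δ) = (δ + (q - 1) * t ^ 2) / (t ^ 2 + δ) := by
    field_simp; ring
  rw [this, le_div_iff₀ h0]
  have h1 := min_le_left 1 (q - 1)
  have h2 := min_le_right 1 (q - 1)
  nlinarith [sq_nonneg t]

theorem Gd_le (q δ t : ℝ) (hq : 1 < q) (hδ : 0 < δ) :
    Gd q δ t ≤ t ^ 2 * (t ^ 2 + δ) ^ (q / 2 - 1) := by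
  set s := t ^ 2 + δ with hs
  have hs0 : 0 < s := by positivity
  have ht : t ^ 2 = s - δ := by rw [hs]; ring
  have hds : δ ≤ s := by rw [hs]; nlinarith [sq_nonneg t]
  unfold Gd
  rw [div_le_iff₀ (by linarith), ← hs, ht, Real.rpow_sub_one hs0.ne']
  set y := δ / s with hy
  have hδy : δ = y * s := by rw [hy]; field_simp
  have hy0 : 0 < y := by positivity
  have hy1 : y ≤ 1 := by rw [hy, div_le_one hs0]; exact hds
  have hsq : 0 < s ^ (q / 2) := by positivity
  have key : 1 - q * (1 - y) ≤ y ^ (q / 2) := by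
    rcases le_total 1 (q / 2) with h | h
    · have := one_add_mul_self_le_rpow_one_add (s := y - 1) (by linarith) h
      rw [add_sub_cancel] at this
      nlinarith
    · have := Real.rpow_le_rpow_of_exponent_ge hy0 hy1 h
      rw [Real.rpow_one] at this
      nlinarith
  rw [hδy, Real.mul_rpow hy0.le hs0.le]
  have : (s - y * s) * (s ^ (q / 2) / s) * q = s ^ (q / 2) * (q * (1 - y)) := by
    field_simp
  rw [this]
  nlinarith

theorem Gd_smooth (q δ : ℝ) (hδ : 0 < δ) : ContDiff ℝ (⊤ : ℕ∞) (Gd q δ) := by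
  unfold Gd
  apply ContDiff.div_const
  apply ContDiff.sub _ contDiff_const
  apply ContDiff.rpow_const_of_ne (by fun_prop)
  intro x; positivity

theorem Gd1_smooth (q δ : ℝ) (hδ : 0 < δ) :
    ContDiff ℝ (⊤ : ℕ∞) (fun t : ℝ => t * (t ^ 2 + δ) ^ (q / 2 - 1)) := by
  apply contDiff_id.mul
  apply ContDiff.rpow_const_of_ne (by fun_prop)
  intro x; positivity

theorem Gd1_bound (q δ t : ℝ) (hq : 1 < q) (hδ : 0 < δ) (hδ1 : δ ≤ 1) :
    |t * (t ^ 2 + δ) ^ (q / 2 - 1)| ≤ (t ^ 2 + 1) ^ ((q - 1) / 2) := by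
  have h0 : 0 < t ^ 2 + δ := by positivity
  rw [abs_mul, abs_of_pos (by positivity : 0 < (t ^ 2 + δ) ^ (q / 2 - 1))]
  have h1 : |t| ≤ (t ^ 2 + δ) ^ ((1 : ℝ) / 2) := by
    rw [← Real.sqrt_eq_rpow]
    apply Real.abs_le_sqrt; linarith
  calc _ ≤ (t ^ 2 + δ) ^ ((1 : ℝ) / 2) * (t ^ 2 + δ) ^ (q / 2 - 1) := by gcongr
    _ = (t ^ 2 + δ) ^ ((q - 1) / 2) := by
      rw [← Real.rpow_add h0]; congr 1; ring
    _ ≤ _ := by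
      apply Real.rpow_le_rpow h0.le (by linarith) (by linarith)

theorem Gd1_lim (q t : ℝ) : Filter.Tendsto
    (fun n : ℕ => t * (t ^ 2 + 1 / ((n : ℝ) + 1)) ^ (q / 2 - 1)) Filter.atTop
    (nhds (t * |t| ^ (q - 2))) := by
  by_cases ht : t = 0
  · subst ht; simp
  apply Filter.Tendsto.const_mul
  have h1 : |t| ^ (q - 2) = (t ^ 2) ^ (q / 2 - 1) := by
    rw [← sq_abs, ← Real.rpow_natCast, ← Real.rpow_mul (abs_nonneg _)]; congr 1; push_cast; ring
  rw [h1]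
  have h2 : Filter.Tendsto (fun n : ℕ => t ^ 2 + 1 / ((n : ℝ) + 1)) Filter.atTop
      (nhds (t ^ 2)) := by
    simpa using (tendsto_one_div_add_atTop_nhds_zero_nat (𝕜 := ℝ)).const_add (t ^ 2)
  exact h2.rpow_const (Or.inl (by positivity))

theorem ibp2 {N : ℕ} {f g : EuclideanSpace ℝ (Fin N) → ℝ} (hf : ContDiff ℝ (⊤ : ℕ∞) f)
    (hg : ContDiff ℝ (⊤ : ℕ∞) g) (hs : HasCompactSupport g) :
    ∫ x, f x * lap g x = ∫ x, lap f x * g x := by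
  unfold lap
  simp only [Finset.mul_sum, Finset.sum_mul]
  rw [integral_finsetSum, integral_finsetSum]
  · apply Finset.sum_congr rfl
    intro i _
    rw [ibp hf (pd_contDiff hg i) (pd_supp hs i) i, ibp (pd_contDiff hf i) hg hs i, neg_neg]
  · intro i _
    exact int_cs ((pd_contDiff (pd_contDiff hf i) i).continuous.mul hg.continuous) hs.mul_left
  · intro i _
    exact int_cs (hf.continuous.mul (pd_contDiff (pd_contDiff hg i) i).continuous)
      (pd_supp (pd_supp hs i) i).mul_left

theorem J_smooth {N : ℕ} :
    ContDiff ℝ (⊤ : ℕ∞) (fun z : EuclideanSpace ℝ (Fin N) => 1 + ‖z‖ ^ 2) :=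
  contDiff_const.add nsq_smooth

theorem Jr_smooth {N : ℕ} (m : ℝ) :
    ContDiff ℝ (⊤ : ℕ∞) (fun z : EuclideanSpace ℝ (Fin N) => (1 + ‖z‖ ^ 2) ^ m) := by
  apply J_smooth.rpow_const_of_ne
  intro x; positivity

theorem pd_J {N : ℕ} (i : Fin N) (z : EuclideanSpace ℝ (Fin N)) :
    pd (fun z : EuclideanSpace ℝ (Fin N) => 1 + ‖z‖ ^ 2) i z = 2 * z i := by
  have := pd_nsq i z
  unfold pd at this ⊢
  rw [fderiv_const_add]
  exact this

theorem pd_Jr {N : ℕ} (m : ℝ) (i : Fin N) (z : EuclideanSpace ℝ (Fin N)) :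
    pd (fun z : EuclideanSpace ℝ (Fin N) => (1 + ‖z‖ ^ 2) ^ m) i z
      = z i * (2 * m * (1 + ‖z‖ ^ 2) ^ (m - 1)) := by
  rw [pd_scalar_comp (φ := fun s => s ^ m) J_smooth i z
    (Real.hasDerivAt_rpow_const (Or.inl (by positivity))), pd_J]
  ring

theorem lap_Jr {N : ℕ} (m : ℝ) : ∃ C : ℝ, 0 ≤ C ∧ ∀ z : EuclideanSpace ℝ (Fin N),
    lap (fun z : EuclideanSpace ℝ (Fin N) => (1 + ‖z‖ ^ 2) ^ m) z ≤ C * (1 + ‖z‖ ^ 2) ^ (m - 1) := by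
  refine ⟨N * (|2 * m| + |4 * m * (m - 1)|), by positivity, ?_⟩
  intro z
  have h : ∀ i, pd (pd (fun z : EuclideanSpace ℝ (Fin N) => (1 + ‖z‖ ^ 2) ^ m) i) i z
      ≤ (|2 * m| + |4 * m * (m - 1)|) * (1 + ‖z‖ ^ 2) ^ (m - 1) := by
    intro i
    have e : pd (fun z : EuclideanSpace ℝ (Fin N) => (1 + ‖z‖ ^ 2) ^ m) i
      = fun z => z i * (2 * m * (1 + ‖z‖ ^ 2) ^ (m - 1)) := funext (pd_Jr m i)
    rw [e, pd_mul (coord_smooth i) (contDiff_const.mul (Jr_smooth (m - 1))), pd_coord,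
      pd_mul contDiff_const (Jr_smooth (m - 1)), pd_Jr]
    have hc : pd (fun _ : EuclideanSpace ℝ (Fin N) => 2 * m) i z = 0 := by
      unfold pd; simp
    rw [hc]
    simp only [if_true, zero_mul, add_zero, one_mul]
    have hJ : 0 < 1 + ‖z‖ ^ 2 := by positivity
    rw [Real.rpow_sub_one hJ.ne' (m - 1)]
    set S := (1 + ‖z‖ ^ 2) ^ (m - 1) with hS
    have hS0 : 0 < S := by positivity
    have hzi : (z i) ^ 2 ≤ 1 + ‖z‖ ^ 2 := by
      have := PiLp.norm_apply_le z i
      rw [Real.norm_eq_abs] at this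
      have := sq_le_sq' (by linarith [abs_nonneg (z i), norm_nonneg z]) this
      rw [sq_abs] at this
      linarith
    have e2 : z i * (2 * m * (z i * (2 * (m - 1) * (S / (1 + ‖z‖ ^ 2))))) + 2 * m * S
        = (4 * m * (m - 1) * ((z i) ^ 2 / (1 + ‖z‖ ^ 2)) + 2 * m) * S := by
      field_simp; ring
    rw [e2]
    apply mul_le_mul_of_nonneg_right _ hS0.le
    have h1 : (z i) ^ 2 / (1 + ‖z‖ ^ 2) ≤ 1 := by rw [div_le_one hJ]; exact hzi
    have h0 : 0 ≤ (z i) ^ 2 / (1 + ‖z‖ ^ 2) := by positivity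
    have h3 := le_abs_self (2 * m)
    have h4 := le_abs_self (4 * m * (m - 1))
    have h5 := abs_nonneg (4 * m * (m - 1))
    nlinarith
  unfold lap
  refine (Finset.sum_le_sum fun i _ => h i).trans ?_
  simp [mul_assoc]

theorem opA_cont {N : ℕ} (α β b c : ℝ) (hα : 2 < α) (hβ : 0 < β)
    {u : EuclideanSpace ℝ (Fin N) → ℝ} (hu : ContDiff ℝ (⊤ : ℕ∞) u) :
    Continuous (opA α β b c u) := by
  have hn : ∀ s : ℝ, 0 < s → Continuous fun x : EuclideanSpace ℝ (Fin N) => ‖x‖ ^ s := fun s hs =>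
    continuous_norm.rpow_const fun x => Or.inr hs.le
  unfold opA
  refine (((continuous_const.add (hn α (by linarith))).mul (lap_cont hu)).add
    ((continuous_const.mul (hn _ (by linarith))).mul
      (continuous_finsetSum _ fun i _ => ?_))).sub
      ((continuous_const.mul (hn _ hβ)).mul hu.continuous)
  exact (coord_smooth i).continuous.mul (pd_contDiff hu i).continuous

theorem opA_supp {N : ℕ} (α β b c : ℝ)
    {u : EuclideanSpace ℝ (Fin N) → ℝ} (hs : HasCompactSupport u) :
    HasCompactSupport (opA α β b c u) := by
  apply HasCompactSupport.intro hs
  intro x hx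
  have h1 : ∀ i, pd u i x = 0 := fun i =>
    image_eq_zero_of_notMem_tsupport fun h => hx (tsupport_fderiv_apply_subset ℝ _ h)
  have h2 : ∀ i, pd (pd u i) i x = 0 := fun i =>
    image_eq_zero_of_notMem_tsupport fun h =>
      hx (tsupport_fderiv_apply_subset ℝ _ (tsupport_fderiv_apply_subset ℝ _ h))
  simp [opA, lap, h1, h2, image_eq_zero_of_notMem_tsupport hx]

theorem lap_Gd {N : ℕ} (q δ : ℝ) (hq : 1 < q) (hδ : 0 < δ)
    {u : EuclideanSpace ℝ (Fin N) → ℝ} (hu : ContDiff ℝ (⊤ : ℕ∞) u)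
    (x : EuclideanSpace ℝ (Fin N)) :
    u x * (u x ^ 2 + δ) ^ (q / 2 - 1) * lap u x
      + min 1 (q - 1) * (u x ^ 2 + δ) ^ (q / 2 - 1) * ∑ i, pd u i x ^ 2
      ≤ lap (fun x => Gd q δ (u x)) x := by
  unfold lap
  rw [Finset.mul_sum, Finset.mul_sum, ← Finset.sum_add_distrib]
  apply Finset.sum_le_sum
  intro i _
  have e : pd (fun x => Gd q δ (u x)) i
      = fun x => (u x * (u x ^ 2 + δ) ^ (q / 2 - 1)) * pd u i x :=
    funext fun x => pd_scalar_comp hu i x (Gd_deriv q δ (u x) hq hδ)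
  rw [e, pd_mul (f := fun x => u x * (u x ^ 2 + δ) ^ (q / 2 - 1))
      ((Gd1_smooth q δ hδ).comp hu) (pd_contDiff hu i),
    pd_scalar_comp (φ := fun t => t * (t ^ 2 + δ) ^ (q / 2 - 1)) hu i x (Gd_deriv2 q δ (u x) hδ)]
  have h := Gd_second_lower q δ (u x) hδ
  have hS : 0 < (u x ^ 2 + δ) ^ (q / 2 - 1) := by positivity
  have h2 := mul_le_mul_of_nonneg_left h (mul_nonneg hS.le (sq_nonneg (pd u i x)))
  nlinarith

theorem Gd_nonneg (q δ t : ℝ) (hq : 1 < q) (hδ : 0 < δ) : 0 ≤ Gd q δ t := by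
  unfold Gd
  apply div_nonneg _ (by linarith)
  have : δ ^ (q / 2) ≤ (t ^ 2 + δ) ^ (q / 2) :=
    Real.rpow_le_rpow hδ.le (by nlinarith [sq_nonneg t]) (by linarith)
  linarith

theorem tau_bound (α r : ℝ) (hα : 2 < α) (hr : 0 ≤ r) :
    (r ^ (α - 2) / (1 + r ^ α)) ^ 2 * r ^ 2 ≤ 2 / (1 + r ^ 2) := by
  have ha : 0 < 1 + r ^ α := by positivity
  have hJ : 0 < 1 + r ^ 2 := by positivity
  rcases le_total r 1 with h | h
  · have h1 : r ^ (α - 2) ≤ 1 := Real.rpow_le_one hr h (by linarith)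
    have h0 : 0 ≤ r ^ (α - 2) := by positivity
    have h2 : r ^ (α - 2) / (1 + r ^ α) ≤ 1 := by
      rw [div_le_one ha]
      have : 0 ≤ r ^ α := by positivity
      linarith
    have h3 : 0 ≤ r ^ (α - 2) / (1 + r ^ α) := by positivity
    have h4 : (r ^ (α - 2) / (1 + r ^ α)) ^ 2 ≤ 1 := by nlinarith
    have h5 : r ^ 2 ≤ 1 := by nlinarith
    have h6 : (r ^ (α - 2) / (1 + r ^ α)) ^ 2 * r ^ 2 ≤ 1 := by nlinarith [sq_nonneg r]
    refine h6.trans ?_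
    rw [le_div_iff₀ hJ]; linarith
  · have hr0 : 0 < r := by linarith
    have e : r ^ α = r ^ (α - 2) * r ^ 2 := by
      rw [← Real.rpow_natCast, ← Real.rpow_add hr0]; congr 1; push_cast; ring
    have h3 : r ^ (α - 2) / (1 + r ^ α) ≤ 1 / r ^ 2 := by
      rw [div_le_div_iff₀ ha (by positivity), e]; linarith
    have h30 : 0 ≤ r ^ (α - 2) / (1 + r ^ α) := by positivity
    have h4 : (r ^ (α - 2) / (1 + r ^ α)) ^ 2 ≤ (1 / r ^ 2) ^ 2 := by gcongr
    calc _ ≤ (1 / r ^ 2) ^ 2 * r ^ 2 := by gcongr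
      _ = 1 / r ^ 2 := by field_simp
      _ ≤ _ := by
        rw [div_le_div_iff₀ (by positivity) hJ]; nlinarith

/-- key integral inequality, before the limit -/
theorem key_ineq (N : ℕ) (α β b c q k : ℝ) (hα : 2 < α) (hβ : 0 < β) (hq : 1 < q) :
    ∃ C : ℝ, 0 ≤ C ∧ ∀ u : EuclideanSpace ℝ (Fin N) → ℝ,
    ContDiff ℝ (⊤ : ℕ∞) u → HasCompactSupport u → ∀ δ : ℝ, 0 < δ →
    0 ≤ ∫ x, (u x * (u x ^ 2 + δ) ^ (q / 2 - 1)) *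
      (C * (1 + ‖x‖ ^ 2) ^ (k / 2 - 1) * u x
        - c * ((1 + ‖x‖ ^ 2) ^ (k / 2) / (1 + ‖x‖ ^ α)) * ‖x‖ ^ β * u x
        - (1 + ‖x‖ ^ 2) ^ (k / 2) / (1 + ‖x‖ ^ α) * opA α β b c u x) := by
  obtain ⟨C₁, hC₁, hlap⟩ := lap_Jr (N := N) (k / 2)
  set m₀ := min 1 (q - 1) with hm₀
  have hm0 : 0 < m₀ := lt_min one_pos (by linarith)
  refine ⟨C₁ + b ^ 2 / (2 * m₀), by positivity, ?_⟩
  intro u hu hs δ hδ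
  set v : EuclideanSpace ℝ (Fin N) → ℝ := fun x => Gd q δ (u x) with hv
  have hvs : ContDiff ℝ (⊤ : ℕ∞) v := (Gd_smooth q δ hδ).comp hu
  have hvc : HasCompactSupport v := hs.comp_left (g := Gd q δ) (by simp [Gd])
  have hn : ∀ s : ℝ, 0 < s → Continuous fun x : EuclideanSpace ℝ (Fin N) => ‖x‖ ^ s := fun s hs =>
    continuous_norm.rpow_const fun x => Or.inr hs.le
  have hJc : ∀ m : ℝ, Continuous fun x : EuclideanSpace ℝ (Fin N) => (1 + ‖x‖ ^ 2) ^ m :=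
    fun m => (Jr_smooth m).continuous
  have hwa : Continuous fun x : EuclideanSpace ℝ (Fin N) =>
      (1 + ‖x‖ ^ 2) ^ (k / 2) / (1 + ‖x‖ ^ α) :=
    (hJc _).div (continuous_const.add (hn α (by linarith))) fun x => by positivity
  have hS : Continuous fun x => u x * (u x ^ 2 + δ) ^ (q / 2 - 1) :=
    ((Gd1_smooth q δ hδ).comp hu).continuous
  have hI1 : Integrable fun x => (1 + ‖x‖ ^ 2) ^ (k / 2) * lap v x
      - lap (fun z : EuclideanSpace ℝ (Fin N) => (1 + ‖z‖ ^ 2) ^ (k / 2)) x * v x := by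
    apply Integrable.sub
    · exact int_cs ((hJc _).mul (lap_cont hvs)) (lap_supp hvc).mul_left
    · exact int_cs ((lap_cont (Jr_smooth _)).mul hvs.continuous) hvc.mul_left
  have hzero : ∫ x, ((1 + ‖x‖ ^ 2) ^ (k / 2) * lap v x
      - lap (fun z : EuclideanSpace ℝ (Fin N) => (1 + ‖z‖ ^ 2) ^ (k / 2)) x * v x) = 0 := by
    rw [integral_sub, ibp2 (Jr_smooth _) hvs hvc, sub_self]
    · exact int_cs ((hJc _).mul (lap_cont hvs)) (lap_supp hvc).mul_left
    · exact int_cs ((lap_cont (Jr_smooth _)).mul hvs.continuous) hvc.mul_left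
  rw [← neg_zero, ← hzero, ← integral_neg]
  have hsum : ∀ x : EuclideanSpace ℝ (Fin N), (∑ i, x i * pd u i x) ^ 2
      ≤ ‖x‖ ^ 2 * ∑ i, pd u i x ^ 2 := by
    intro x
    rw [EuclideanSpace.real_norm_sq_eq]
    exact Finset.sum_mul_sq_le_sq_mul_sq _ _ _
  apply integral_mono hI1.neg
  · apply int_cs
    · exact hS.mul ((((continuous_const.mul (hJc _)).mul hu.continuous).sub
        (((continuous_const.mul hwa).mul (hn β hβ)).mul hu.continuous)).sub
        (hwa.mul (opA_cont α β b c hα hβ hu)))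
    · exact (hs.comp_left (g := fun t => t * (t ^ 2 + δ) ^ (q / 2 - 1)) (by simp)).mul_right
  intro x
  have hlG := lap_Gd q δ hq hδ hu x
  have hl1 := hlap x
  have hvn := Gd_nonneg q δ (u x) hq hδ
  have hvl := Gd_le q δ (u x) hq hδ
  have hτ := tau_bound α ‖x‖ hα (norm_nonneg x)
  have hsx := hsum x
  have hJ : 0 < 1 + ‖x‖ ^ 2 := by positivity
  have ha : 0 < 1 + ‖x‖ ^ α := by positivity
  have hW : 0 < (1 + ‖x‖ ^ 2) ^ (k / 2) := by positivity
  have hS0 : 0 < (u x ^ 2 + δ) ^ (q / 2 - 1) := by positivity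
  have hJ' : (1 + ‖x‖ ^ 2) ^ (k / 2 - 1) = (1 + ‖x‖ ^ 2) ^ (k / 2) / (1 + ‖x‖ ^ 2) :=
    Real.rpow_sub_one hJ.ne' _
  have hG : 0 ≤ ∑ i, pd u i x ^ 2 := Finset.sum_nonneg fun i _ => sq_nonneg _
  simp only [opA, Pi.neg_apply]
  rw [← hv, ← hm₀] at hlG
  generalize lap (fun z : EuclideanSpace ℝ (Fin N) => (1 + ‖z‖ ^ 2) ^ (k / 2)) x = Lw at *
  rw [hJ'] at hl1 ⊢
  have hvx : v x = Gd q δ (u x) := rfl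
  rw [← hvx] at hvn hvl
  generalize hSS : (u x ^ 2 + δ) ^ (q / 2 - 1) = S at *
  generalize (1 + ‖x‖ ^ 2) ^ (k / 2) = W at *
  generalize v x = V at *
  generalize lap v x = Lv at *
  generalize lap u x = l at *
  generalize ∑ i, x i * pd u i x = D at *
  generalize ∑ i, pd u i x ^ 2 = G at *
  generalize ‖x‖ ^ (α - 2) = n2 at *
  generalize ‖x‖ ^ β = nb at *
  generalize 1 + ‖x‖ ^ α = a at *
  generalize u x = t at *
  have hD : b * (n2 / a) * t * D ≤ m₀ * G + b ^ 2 * t ^ 2 / (2 * m₀ * (1 + ‖x‖ ^ 2)) := by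
    refine (le_abs_self _).trans (abs_le_of_sq_le_sq ?_ (by positivity))
    have e1 : (b * (n2 / a) * t * D) ^ 2 ≤ b ^ 2 * t ^ 2 * (2 / (1 + ‖x‖ ^ 2)) * G := by
      calc (b * (n2 / a) * t * D) ^ 2 = (b ^ 2 * t ^ 2 * (n2 / a) ^ 2) * D ^ 2 := by ring
        _ ≤ (b ^ 2 * t ^ 2 * (n2 / a) ^ 2) * (‖x‖ ^ 2 * G) := by gcongr
        _ = b ^ 2 * t ^ 2 * ((n2 / a) ^ 2 * ‖x‖ ^ 2) * G := by ring
        _ ≤ _ := by gcongr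
    refine e1.trans ?_
    have e2 : b ^ 2 * t ^ 2 * (2 / (1 + ‖x‖ ^ 2)) * G
      = 4 * (m₀ * G) * (b ^ 2 * t ^ 2 / (2 * m₀ * (1 + ‖x‖ ^ 2))) := by
      field_simp; ring
    rw [e2]
    nlinarith [sq_nonneg (m₀ * G - b ^ 2 * t ^ 2 / (2 * m₀ * (1 + ‖x‖ ^ 2)))]
  have h1 : Lw * V ≤ C₁ * (W / (1 + ‖x‖ ^ 2)) * (t ^ 2 * S) :=
    (mul_le_mul_of_nonneg_right hl1 hvn).trans (mul_le_mul_of_nonneg_left hvl (by positivity))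
  have h2 := mul_le_mul_of_nonneg_left hlG hW.le
  have h3 := mul_le_mul_of_nonneg_left hD (mul_nonneg hW.le hS0.le)
  have e : t * S * ((C₁ + b ^ 2 / (2 * m₀)) * (W / (1 + ‖x‖ ^ 2)) * t - c * (W / a) * nb * t
      - W / a * (a * l + b * n2 * D - c * nb * t))
      = C₁ * (W / (1 + ‖x‖ ^ 2)) * (t ^ 2 * S)
        + W * S * (b ^ 2 * t ^ 2 / (2 * m₀ * (1 + ‖x‖ ^ 2)))
        - W * (t * S * l) - W * S * (b * (n2 / a) * t * D) := by
    field_simp; ring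
  rw [e]
  linarith

theorem key_lim (N : ℕ) (α β b c q k : ℝ) (hα : 2 < α) (hβ : 0 < β) (hq : 1 < q) :
    ∃ C : ℝ, 0 ≤ C ∧ ∀ u : EuclideanSpace ℝ (Fin N) → ℝ,
    ContDiff ℝ (⊤ : ℕ∞) u → HasCompactSupport u →
    (Integrable fun x => (u x * |u x| ^ (q - 2)) *
      (C * (1 + ‖x‖ ^ 2) ^ (k / 2 - 1) * u x
        - c * ((1 + ‖x‖ ^ 2) ^ (k / 2) / (1 + ‖x‖ ^ α)) * ‖x‖ ^ β * u x
        - (1 + ‖x‖ ^ 2) ^ (k / 2) / (1 + ‖x‖ ^ α) * opA α β b c u x)) ∧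
    0 ≤ ∫ x, (u x * |u x| ^ (q - 2)) *
      (C * (1 + ‖x‖ ^ 2) ^ (k / 2 - 1) * u x
        - c * ((1 + ‖x‖ ^ 2) ^ (k / 2) / (1 + ‖x‖ ^ α)) * ‖x‖ ^ β * u x
        - (1 + ‖x‖ ^ 2) ^ (k / 2) / (1 + ‖x‖ ^ α) * opA α β b c u x) := by
  obtain ⟨C, hC, h⟩ := key_ineq N α β b c q k hα hβ hq
  refine ⟨C, hC, ?_⟩
  intro u hu hs
  have hn : ∀ s : ℝ, 0 < s → Continuous fun x : EuclideanSpace ℝ (Fin N) => ‖x‖ ^ s := fun s hs =>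
    continuous_norm.rpow_const fun x => Or.inr hs.le
  have hJc : ∀ m : ℝ, Continuous fun x : EuclideanSpace ℝ (Fin N) => (1 + ‖x‖ ^ 2) ^ m :=
    fun m => (Jr_smooth m).continuous
  have hwa : Continuous fun x : EuclideanSpace ℝ (Fin N) =>
      (1 + ‖x‖ ^ 2) ^ (k / 2) / (1 + ‖x‖ ^ α) :=
    (hJc _).div (continuous_const.add (hn α (by linarith))) fun x => by positivity
  set R : EuclideanSpace ℝ (Fin N) → ℝ := fun x => C * (1 + ‖x‖ ^ 2) ^ (k / 2 - 1) * u x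
        - c * ((1 + ‖x‖ ^ 2) ^ (k / 2) / (1 + ‖x‖ ^ α)) * ‖x‖ ^ β * u x
        - (1 + ‖x‖ ^ 2) ^ (k / 2) / (1 + ‖x‖ ^ α) * opA α β b c u x with hR
  have hRc : Continuous R := (((continuous_const.mul (hJc _)).mul hu.continuous).sub
        (((continuous_const.mul hwa).mul (hn β hβ)).mul hu.continuous)).sub
        (hwa.mul (opA_cont α β b c hα hβ hu))
  have hRs : HasCompactSupport R := (hs.mul_left.sub hs.mul_left).sub (opA_supp α β b c hs).mul_left
  have hlim : Filter.Tendsto (fun n : ℕ => ∫ x, (u x * (u x ^ 2 + 1 / ((n : ℝ) + 1)) ^ (q / 2 - 1)) * R x)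
      Filter.atTop (nhds (∫ x, (u x * |u x| ^ (q - 2)) * R x)) := by
    apply tendsto_integral_of_dominated_convergence
      (fun x => (u x ^ 2 + 1) ^ ((q - 1) / 2) * |R x|)
    · intro n
      exact ((((Gd1_smooth q _ (by positivity)).comp hu).continuous).mul hRc).aestronglyMeasurable
    · apply int_cs
      · refine Continuous.mul ?_ hRc.abs
        refine ((hu.continuous.pow 2).add continuous_const).rpow_const fun x => Or.inr (by linarith)
      · exact (hRs.comp_left (g := fun t => |t|) (by simp)).mul_left
    · intro n
      refine Filter.Eventually.of_forall fun x => ?_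
      rw [Real.norm_eq_abs, abs_mul]
      apply mul_le_mul_of_nonneg_right _ (abs_nonneg _)
      apply Gd1_bound q _ _ hq (by positivity)
      rw [div_le_one (by positivity)]
      have : (0 : ℝ) ≤ n := by positivity
      linarith
    · refine Filter.Eventually.of_forall fun x => ?_
      exact (Gd1_lim q (u x)).mul_const _
  refine ⟨?_, ?_⟩
  · have hm : AEStronglyMeasurable (fun x => (u x * |u x| ^ (q - 2)) * R x) volume := by
      have h1 := hu.continuous.measurable
      have h2 := hRc.measurable
      apply Measurable.aestronglyMeasurable
      fun_prop
    have hi : Integrable fun x => |u x| ^ (q - 1) * |R x| := by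
      apply int_cs
      · exact (hu.continuous.abs.rpow_const fun x => Or.inr (by linarith)).mul hRc.abs
      · exact (hRs.comp_left (g := fun t => |t|) (by simp)).mul_left
    refine hi.mono' hm (Filter.Eventually.of_forall fun x => ?_)
    rw [Real.norm_eq_abs, abs_mul]
    apply mul_le_mul_of_nonneg_right _ (abs_nonneg _)
    by_cases h : u x = 0
    · rw [h]; simp [Real.zero_rpow (by linarith : q - 1 ≠ 0)]
    · have : |u x| ^ (q - 1) = |u x| ^ (q - 2) * |u x| ^ (1 : ℝ) := by
        rw [← Real.rpow_add (by positivity)]; congr 1; ring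
      rw [this, Real.rpow_one, abs_mul, abs_of_nonneg (by positivity : 0 ≤ |u x| ^ (q - 2))]
      linarith
  exact ge_of_tendsto' hlim fun n => h u hu hs _ (by positivity)

set_option maxHeartbeats 1600000 in
theorem ptw_pot (α β c q C : ℝ) (hα : 2 < α) (hβ : α - 2 < β) (hq : 1 < q) (hc : 0 < c)
    (hC : 0 ≤ C) :
    ∃ η C₃ : ℝ, 0 < η ∧ 0 ≤ C₃ ∧ ∀ r t f : ℝ, 0 ≤ r →
    (t * |t| ^ (q - 2)) *
      (C * (1 + r ^ 2) ^ ((α + β * (q - 1)) / 2 - 1) * t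
        - c * ((1 + r ^ 2) ^ ((α + β * (q - 1)) / 2) / (1 + r ^ α)) * r ^ β * t
        - (1 + r ^ 2) ^ ((α + β * (q - 1)) / 2) / (1 + r ^ α) * f)
      ≤ -η * ((1 + r ^ 2) ^ (β / 2 * q) * |t| ^ q) + C₃ * (|f| ^ q + |t| ^ q) := by
  have hβ0 : 0 < β := by linarith
  set κ : ℝ := (1 / 2) ^ (β / 2) with hκ
  have hκ0 : 0 < κ := by positivity
  set A : ℝ := 2 ^ (α / 2) with hA
  have hA0 : 0 < A := by positivity
  set η := c * κ / 8 with hη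
  have hη0 : 0 < η := by positivity
  obtain ⟨C1, hC1, h1⟩ := lower_s (β / 2 * q) ((β - (α - 2)) / 2) (by positivity) (by linarith)
    (η / (C + 1)) (by positivity)
  obtain ⟨C2, hC2, h2⟩ := lower_s (β / 2 * q) (β / 2) (by positivity) (by linarith)
    (η / (c * A)) (by positivity)
  obtain ⟨C4, hC4, h4⟩ := young_s q hq η hη0
  refine ⟨η, C * C1 + c * A * C2 + C4 * A ^ q, hη0, by positivity, ?_⟩
  intro r t f hr
  have hJ1 : 1 ≤ 1 + r ^ 2 := by nlinarith [sq_nonneg r]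
  set J := 1 + r ^ 2 with hJ
  have hJ0 : 0 < J := by linarith
  have hra : 0 ≤ r ^ α := by positivity
  have ha : 0 < 1 + r ^ α := by linarith
  have hpow : ∀ s : ℝ, 0 < s → r ^ s ≤ J ^ (s / 2) := by
    intro s hs
    calc r ^ s = (r ^ 2) ^ (s / 2) := by
          rw [← Real.rpow_natCast, ← Real.rpow_mul hr]; congr 1; push_cast; ring
      _ ≤ _ := Real.rpow_le_rpow (by positivity) (by linarith) (by linarith)
  have hpow2 : ∀ s : ℝ, 0 < s → J ^ (s / 2) ≤ 2 ^ (s / 2) * (1 + r ^ s) := by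
    intro s hs
    have hrs : 0 ≤ r ^ s := by positivity
    have h2s : (0 : ℝ) < 2 ^ (s / 2) := by positivity
    rcases le_total r 1 with h | h
    · have : J ^ (s / 2) ≤ 2 ^ (s / 2) := Real.rpow_le_rpow hJ0.le (by nlinarith) (by linarith)
      nlinarith
    · have : J ^ (s / 2) ≤ (2 * r ^ 2) ^ (s / 2) :=
        Real.rpow_le_rpow hJ0.le (by nlinarith) (by linarith)
      rw [Real.mul_rpow (by norm_num) (by positivity), ← Real.rpow_natCast, ← Real.rpow_mul hr] at this
      have e : ((2 : ℕ) : ℝ) * (s / 2) = s := by push_cast; ring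
      rw [e] at this
      nlinarith
  have hone : 1 ≤ J ^ (α / 2) := Real.one_le_rpow hJ1 (by linarith)
  set Q := J ^ (β / 2 * (q - 1)) with hQ
  have hQ0 : 0 < Q := by positivity
  have hW : J ^ ((α + β * (q - 1)) / 2) = J ^ (α / 2) * Q := by
    rw [hQ, ← Real.rpow_add hJ0]; congr 1; ring
  have hWl : Q / 2 ≤ J ^ ((α + β * (q - 1)) / 2) / (1 + r ^ α) := by
    rw [hW, div_le_div_iff₀ two_pos ha]
    have := hpow α (by linarith)
    nlinarith
  have hWu : J ^ ((α + β * (q - 1)) / 2) / (1 + r ^ α) ≤ A * Q := by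
    rw [hW, div_le_iff₀ ha]
    have := hpow2 α (by linarith)
    nlinarith
  set w := J ^ ((α + β * (q - 1)) / 2) / (1 + r ^ α) with hw
  have hw0 : 0 < w := by positivity
  have hrb : κ * J ^ (β / 2) - 1 ≤ r ^ β := by
    have h := hpow2 β hβ0
    have e : κ * 2 ^ (β / 2) = 1 := by
      rw [hκ, ← Real.mul_rpow (by norm_num) (by norm_num)]; norm_num
    have := mul_le_mul_of_nonneg_left h hκ0.le
    rw [← mul_assoc, e] at this
    linarith
  have hP : J ^ (β / 2 * q) = Q * J ^ (β / 2) := by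
    rw [hQ, ← Real.rpow_add hJ0]; congr 1; ring
  have hJ1' := h1 J hJ1
  have e1 : β / 2 * q - (β - (α - 2)) / 2 = (α + β * (q - 1)) / 2 - 1 := by ring
  rw [e1] at hJ1'
  have hJ2' := h2 J hJ1
  have e2 : β / 2 * q - β / 2 = β / 2 * (q - 1) := by ring
  rw [e2, ← hQ] at hJ2'
  have ht1 : t * |t| ^ (q - 2) * t = |t| ^ q := by
    by_cases h : t = 0
    · subst h; simp [Real.zero_rpow (by linarith : q ≠ 0)]
    · have : |t| ^ q = |t| ^ (q - 2) * |t| ^ (2 : ℝ) := by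
        rw [← Real.rpow_add (by positivity)]; congr 1; ring
      rw [this, Real.rpow_two, sq_abs]; ring
  have ht2 : |t * |t| ^ (q - 2)| = |t| ^ (q - 1) := by
    by_cases h : t = 0
    · subst h; simp [Real.zero_rpow (by linarith : q - 1 ≠ 0)]
    · have : |t| ^ (q - 1) = |t| ^ (q - 2) * |t| ^ (1 : ℝ) := by
        rw [← Real.rpow_add (by positivity)]; congr 1; ring
      rw [this, Real.rpow_one, abs_mul, abs_of_nonneg (by positivity : 0 ≤ |t| ^ (q - 2))]; ring
  have hT0 : 0 ≤ |t| ^ q := by positivity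
  have hF0 : 0 ≤ |f| ^ q := by positivity
  -- the term with f
  have hf : -(w * f * (t * |t| ^ (q - 2))) ≤ η * (J ^ (β / 2 * q) * |t| ^ q) + C4 * A ^ q * |f| ^ q := by
    have h5 := h4 (A * |f|) (J ^ (β / 2) * |t|) (by positivity) (by positivity)
    rw [Real.mul_rpow (by positivity) (abs_nonneg _), Real.mul_rpow (by positivity) (abs_nonneg _),
      Real.mul_rpow (by positivity) (abs_nonneg _), ← Real.rpow_mul hJ0.le, ← Real.rpow_mul hJ0.le,
      ← hQ] at h5
    have h6 : -(w * f * (t * |t| ^ (q - 2))) ≤ w * |f| * |t| ^ (q - 1) := by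
      refine (neg_le_abs _).trans ?_
      rw [abs_mul, abs_mul, ht2, abs_of_pos hw0]
    have h7 : w * |f| * |t| ^ (q - 1) ≤ A * Q * |f| * |t| ^ (q - 1) := by gcongr
    linarith
  have hg : C * J ^ ((α + β * (q - 1)) / 2 - 1) - c * w * r ^ β
      ≤ -2 * η * J ^ (β / 2 * q) + (C * C1 + c * A * C2) := by
    have g1 : C * J ^ ((α + β * (q - 1)) / 2 - 1) ≤ η * J ^ (β / 2 * q) + C * C1 := by
      have := mul_le_mul_of_nonneg_left hJ1' hC
      have g3 : C * (η / (C + 1)) ≤ η := by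
        rw [mul_div_assoc', div_le_iff₀ (by linarith)]; nlinarith
      have g4 : 0 < J ^ (β / 2 * q) := by positivity
      nlinarith
    have g2 : w * (κ * J ^ (β / 2) - 1) ≤ w * r ^ β := mul_le_mul_of_nonneg_left hrb hw0.le
    have g5 : Q / 2 * (κ * J ^ (β / 2)) ≤ w * (κ * J ^ (β / 2)) := by gcongr
    have g6 : c * A * Q ≤ η * J ^ (β / 2 * q) + c * A * C2 := by
      have := mul_le_mul_of_nonneg_left hJ2' (by positivity : 0 ≤ c * A)
      have g3 : c * A * (η / (c * A)) = η := by field_simp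
      calc _ ≤ _ := this
        _ = (c * A * (η / (c * A))) * J ^ (β / 2 * q) + c * A * C2 := by ring
        _ = _ := by rw [g3]
    have g7 : c * (Q / 2 * (κ * J ^ (β / 2))) = 4 * η * J ^ (β / 2 * q) := by
      rw [hP, hη]; ring
    have g8 : c * w ≤ c * (A * Q) := by gcongr
    have g9 := mul_le_mul_of_nonneg_left g2 hc.le
    have g10 := mul_le_mul_of_nonneg_left g5 hc.le
    nlinarith
  have hg2 := mul_le_mul_of_nonneg_right hg hT0
  calc _ = (C * J ^ ((α + β * (q - 1)) / 2 - 1) - c * w * r ^ β) * (t * |t| ^ (q - 2) * t)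
        + -(w * f * (t * |t| ^ (q - 2))) := by ring
    _ ≤ (-2 * η * J ^ (β / 2 * q) + (C * C1 + c * A * C2)) * |t| ^ q
        + (η * (J ^ (β / 2 * q) * |t| ^ q) + C4 * A ^ q * |f| ^ q) := by
      rw [ht1]; exact add_le_add hg2 hf
    _ ≤ _ := by
      have k1 : 0 ≤ (C * C1 + c * A * C2) * |f| ^ q := by positivity
      have k2 : 0 ≤ C4 * A ^ q * |t| ^ q := by positivity
      nlinarith

theorem pot_bound (N : ℕ) (α β b c : ℝ) (hα : 2 < α) (hβ : α - 2 < β) (hc : 0 < c)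
    (p : ℝ≥0∞) (hp1 : 1 < p) (hp2 : p ≠ ⊤) :
    ∃ K : ℝ, 0 ≤ K ∧ ∀ u : EuclideanSpace ℝ (Fin N) → ℝ, ContDiff ℝ (⊤ : ℕ∞) u →
      HasCompactSupport u →
      eLpNorm (fun x => (1 + ‖x‖ ^ 2) ^ (β / 2) * u x) p volume ≤
        ENNReal.ofReal K * (eLpNorm (fun x => opA α β b c u x) p volume + eLpNorm u p volume) := by
  have hβ0 : 0 < β := by linarith
  set q := p.toReal with hqd
  have hq : 1 < q := by
    rw [hqd, ← ENNReal.toReal_one]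
    exact (ENNReal.toReal_lt_toReal (by simp) hp2).2 hp1
  obtain ⟨C, hC, hkey⟩ := key_lim N α β b c q (α + β * (q - 1)) hα hβ0 hq
  obtain ⟨η, C₃, hη, hC₃, hpt⟩ := ptw_pot α β c q C hα hβ hq hc hC
  refine ⟨(C₃ / η) ^ q⁻¹, by positivity, ?_⟩
  intro u hu hs
  have hn : ∀ s : ℝ, 0 < s → Continuous fun x : EuclideanSpace ℝ (Fin N) => ‖x‖ ^ s := fun s hs =>
    continuous_norm.rpow_const fun x => Or.inr hs.le
  have hJc : ∀ m : ℝ, Continuous fun x : EuclideanSpace ℝ (Fin N) => (1 + ‖x‖ ^ 2) ^ m :=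
    fun m => (Jr_smooth m).continuous
  have hwa : Continuous fun x : EuclideanSpace ℝ (Fin N) =>
      (1 + ‖x‖ ^ 2) ^ ((α + β * (q - 1)) / 2) / (1 + ‖x‖ ^ α) :=
    (hJc _).div (continuous_const.add (hn α (by linarith))) fun x => by positivity
  have hAc := opA_cont α β b c hα hβ0 hu
  have hAs := opA_supp α β b c hs
  have hp0 : p ≠ 0 := by rintro rfl; simp at hp1
  have hmem : ∀ f : EuclideanSpace ℝ (Fin N) → ℝ, Continuous f → HasCompactSupport f →
      MemLp f p volume := fun f h1 h2 => h1.memLp_of_hasCompactSupport h2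
  have hintg : ∀ f : EuclideanSpace ℝ (Fin N) → ℝ, Continuous f → HasCompactSupport f →
      Integrable (fun x => |f x| ^ q) := fun f h1 h2 =>
    int_cs (h1.abs.rpow_const fun x => Or.inr (by linarith))
      (h2.comp_left (g := fun t => |t| ^ q) (by simp [Real.zero_rpow (by linarith : q ≠ 0)]))
  have hgc : Continuous fun x => (1 + ‖x‖ ^ 2) ^ (β / 2) * u x := (hJc _).mul hu.continuous
  have hgs : HasCompactSupport fun x => (1 + ‖x‖ ^ 2) ^ (β / 2) * u x := hs.mul_left
  have hI : η * ∫ x, |(1 + ‖x‖ ^ 2) ^ (β / 2) * u x| ^ q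
      ≤ C₃ * ((∫ x, |opA α β b c u x| ^ q) + ∫ x, |u x| ^ q) := by
    obtain ⟨hi0, h0⟩ := hkey u hu hs
    have h1 : (0 : ℝ) ≤ ∫ x, (-η * |(1 + ‖x‖ ^ 2) ^ (β / 2) * u x| ^ q
        + C₃ * (|opA α β b c u x| ^ q + |u x| ^ q)) := by
      refine h0.trans (integral_mono hi0 ?_ ?_)
      · exact ((hintg _ hgc hgs).const_mul _).add
          (((hintg _ hAc hAs).add (hintg _ hu.continuous hs)).const_mul _)
      · intro x
        have := hpt ‖x‖ (u x) (opA α β b c u x) (norm_nonneg x)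
        have e : |(1 + ‖x‖ ^ 2) ^ (β / 2) * u x| ^ q
            = (1 + ‖x‖ ^ 2) ^ (β / 2 * q) * |u x| ^ q := by
          rw [abs_mul, abs_of_nonneg (by positivity : 0 ≤ (1 + ‖x‖ ^ 2) ^ (β / 2)),
            Real.mul_rpow (by positivity) (abs_nonneg _), ← Real.rpow_mul (by positivity)]
        simp only [e]
        exact this
    rw [integral_add, integral_const_mul, integral_const_mul, integral_add] at h1
    · linarith
    · exact hintg _ hAc hAs
    · exact hintg _ hu.continuous hs
    · exact (hintg _ hgc hgs).const_mul _
    · exact ((hintg _ hAc hAs).add (hintg _ hu.continuous hs)).const_mul _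
  rw [(hmem _ hgc hgs).eLpNorm_eq_integral_rpow_norm hp0 hp2,
    (hmem _ hAc hAs).eLpNorm_eq_integral_rpow_norm hp0 hp2,
    (hmem _ hu.continuous hs).eLpNorm_eq_integral_rpow_norm hp0 hp2]
  simp only [Real.norm_eq_abs, ← hqd]
  have nn : ∀ f : EuclideanSpace ℝ (Fin N) → ℝ, 0 ≤ ∫ x, |f x| ^ q := fun f =>
    integral_nonneg fun x => by positivity
  have n1 := nn fun x => (1 + ‖x‖ ^ 2) ^ (β / 2) * u x
  have n2 := nn fun x => opA α β b c u x
  have n3 := nn u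
  rw [← ENNReal.ofReal_add (by positivity) (by positivity), ← ENNReal.ofReal_mul (by positivity)]
  apply ENNReal.ofReal_le_ofReal
  have hq1 : q⁻¹ ≤ 1 := inv_le_one_of_one_le₀ hq.le
  calc _ ≤ (C₃ / η * ((∫ x, |opA α β b c u x| ^ q) + ∫ x, |u x| ^ q)) ^ q⁻¹ := by
        apply Real.rpow_le_rpow n1 _ (by positivity)
        rw [div_mul_eq_mul_div, le_div_iff₀ hη]; linarith
    _ = (C₃ / η) ^ q⁻¹ * ((∫ x, |opA α β b c u x| ^ q) + ∫ x, |u x| ^ q) ^ q⁻¹ :=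
        Real.mul_rpow (by positivity) (by positivity)
    _ ≤ _ := by
        gcongr
        exact Real.rpow_add_le_add_rpow n2 n3 (by positivity) hq1

theorem eLp_dom {N : ℕ} (p : ℝ≥0∞) (k : ℝ) (hk : 0 ≤ k) {f g : EuclideanSpace ℝ (Fin N) → ℝ}
    (h : ∀ x, |g x| ≤ k * |f x|) :
    eLpNorm g p volume ≤ ENNReal.ofReal k * eLpNorm f p volume :=
  eLpNorm_le_mul_eLpNorm_of_ae_le_mul (Filter.Eventually.of_forall fun x => by
    simpa [Real.norm_eq_abs] using h x) p

theorem sqrt_sum_le {N : ℕ} (a : Fin N → ℝ) : Real.sqrt (∑ i, a i ^ 2) ≤ ∑ i, |a i| := by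
  rw [Real.sqrt_le_left (Finset.sum_nonneg fun i _ => abs_nonneg _)]
  have : ∀ s : Finset (Fin N), ∑ i ∈ s, a i ^ 2 ≤ (∑ i ∈ s, |a i|) ^ 2 := by
    intro s
    induction s using Finset.cons_induction with
    | empty => simp
    | cons i s hi ih =>
      rw [Finset.sum_cons, Finset.sum_cons]
      have h1 : 0 ≤ ∑ i ∈ s, |a i| := Finset.sum_nonneg fun i _ => abs_nonneg _
      have h2 := abs_nonneg (a i)
      have h3 := sq_abs (a i)
      nlinarith [mul_nonneg h1 h2]
  exact this _

theorem one_add_rpow_le (s r : ℝ) (hs : 0 < s) (hr : 0 ≤ r) :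
    (1 + r) ^ s ≤ 2 ^ s * (1 + r ^ s) := by
  have hrs : 0 ≤ r ^ s := by positivity
  have h2s : (0 : ℝ) < 2 ^ s := by positivity
  rcases le_total r 1 with h | h
  · have : (1 + r) ^ s ≤ 2 ^ s := Real.rpow_le_rpow (by linarith) (by linarith) hs.le
    nlinarith
  · have : (1 + r) ^ s ≤ (2 * r) ^ s := Real.rpow_le_rpow (by linarith) (by linarith) hs.le
    rw [Real.mul_rpow (by norm_num) hr] at this
    nlinarith

theorem pot_bound2 (N : ℕ) (α β b c : ℝ) (hα : 2 < α) (hβ : α - 2 < β) (hc : 0 < c)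
    (p : ℝ≥0∞) (hp1 : 1 < p) (hp2 : p ≠ ⊤) :
    ∃ K : ℝ, 0 ≤ K ∧ ∀ u : EuclideanSpace ℝ (Fin N) → ℝ, ContDiff ℝ (⊤ : ℕ∞) u →
      HasCompactSupport u →
      eLpNorm (fun x => (1 + ‖x‖) ^ β * u x) p volume ≤
        ENNReal.ofReal K * (eLpNorm (fun x => opA α β b c u x) p volume + eLpNorm u p volume) := by
  obtain ⟨K, hK, h⟩ := pot_bound N α β b c hα hβ hc p hp1 hp2
  refine ⟨2 ^ (β / 2) * K, by positivity, ?_⟩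
  intro u hu hs
  refine (eLp_dom p (2 ^ (β / 2)) (by positivity)
    (f := fun x => (1 + ‖x‖ ^ 2) ^ (β / 2) * u x) ?_).trans ?_
  · intro x
    rw [abs_mul, abs_mul, ← mul_assoc]
    apply mul_le_mul_of_nonneg_right _ (abs_nonneg _)
    rw [abs_of_nonneg (by positivity), abs_of_nonneg (by positivity),
      ← Real.mul_rpow (by norm_num) (by positivity)]
    have e : (1 + ‖x‖) ^ β = ((1 + ‖x‖) ^ 2) ^ (β / 2) := by
      rw [← Real.rpow_natCast, ← Real.rpow_mul (by positivity)]; congr 1; push_cast; ring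
    rw [e]
    apply Real.rpow_le_rpow (by positivity) _ (by linarith)
    nlinarith [sq_nonneg (1 - ‖x‖)]
  · rw [ENNReal.ofReal_mul (by positivity), mul_assoc]
    gcongr
    exact h u hu hs

theorem lap_ptw {N : ℕ} (α β b c : ℝ) (hα : 2 < α) (hβ : α - 2 < β) (hc : 0 < c)
    (u : EuclideanSpace ℝ (Fin N) → ℝ) (x : EuclideanSpace ℝ (Fin N)) :
    |(1 + ‖x‖) ^ α * lap u x| ≤ 2 ^ α * |((|opA α β b c u x| +
      |b| * ∑ i, |(1 + ‖x‖) ^ (α - 1) * pd u i x|) + c * |(1 + ‖x‖) ^ β * u x|)| := by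
  have hr := norm_nonneg x
  have hsum0 : 0 ≤ ∑ i, |pd u i x| := Finset.sum_nonneg fun i _ => abs_nonneg _
  have e1 : ∑ i, |(1 + ‖x‖) ^ (α - 1) * pd u i x| = (1 + ‖x‖) ^ (α - 1) * ∑ i, |pd u i x| := by
    rw [Finset.mul_sum]
    apply Finset.sum_congr rfl
    intro i _
    rw [abs_mul, abs_of_nonneg (by positivity)]
  rw [e1, abs_of_nonneg (by positivity : 0 ≤ |opA α β b c u x| +
      |b| * ((1 + ‖x‖) ^ (α - 1) * ∑ i, |pd u i x|) + c * |(1 + ‖x‖) ^ β * u x|)]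
  rw [abs_mul, abs_of_nonneg (by positivity : 0 ≤ (1 + ‖x‖) ^ α)]
  refine (mul_le_mul_of_nonneg_right (one_add_rpow_le α ‖x‖ (by linarith) hr)
    (abs_nonneg _)).trans ?_
  rw [mul_assoc]
  apply mul_le_mul_of_nonneg_left _ (by positivity)
  have e2 : (1 + ‖x‖ ^ α) * |lap u x| = |opA α β b c u x
      - b * ‖x‖ ^ (α - 2) * (∑ i, x i * pd u i x) + c * ‖x‖ ^ β * u x| := by
    rw [← abs_of_nonneg (by positivity : 0 ≤ 1 + ‖x‖ ^ α), ← abs_mul]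
    congr 1
    unfold opA
    ring
  rw [e2]
  refine (abs_add_le _ _).trans (add_le_add ((abs_sub _ _).trans (add_le_add le_rfl ?_)) ?_)
  · have hD : |∑ i, x i * pd u i x| ≤ ‖x‖ * ∑ i, |pd u i x| := by
      refine (Finset.abs_sum_le_sum_abs _ _).trans ?_
      rw [Finset.mul_sum]
      apply Finset.sum_le_sum
      intro i _
      rw [abs_mul]
      gcongr
      exact PiLp.norm_apply_le x i
    rw [abs_mul, abs_mul, abs_of_nonneg (by positivity : 0 ≤ ‖x‖ ^ (α - 2)), mul_assoc]
    apply mul_le_mul_of_nonneg_left _ (abs_nonneg _)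
    calc _ ≤ ‖x‖ ^ (α - 2) * (‖x‖ * ∑ i, |pd u i x|) := by gcongr
      _ ≤ (1 + ‖x‖) ^ (α - 2) * ((1 + ‖x‖) * ∑ i, |pd u i x|) := by
        gcongr <;> linarith
      _ = (1 + ‖x‖) ^ (α - 1) * ∑ i, |pd u i x| := by
        rw [← mul_assoc, ← Real.rpow_add_one (by positivity)]
        congr 2; ring
  · rw [abs_mul, abs_mul, abs_mul, abs_of_pos hc, mul_assoc, abs_of_nonneg (by positivity : 0 ≤ ‖x‖ ^ β),
      abs_of_nonneg (by positivity : 0 ≤ (1 + ‖x‖) ^ β)]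
    have : ‖x‖ ^ β ≤ (1 + ‖x‖) ^ β := Real.rpow_le_rpow hr (by linarith) (by linarith)
    gcongr

theorem eLp_sum_abs {N : ℕ} (p : ℝ≥0∞) (hp : 1 ≤ p) (g : Fin N → EuclideanSpace ℝ (Fin N) → ℝ)
    (hg : ∀ i, Continuous (g i)) :
    eLpNorm (fun x => ∑ i, |g i x|) p volume ≤ ∑ i, eLpNorm (g i) p volume := by
  have h := eLpNorm_sum_le (μ := volume) (p := p) (s := Finset.univ)
      (f := fun i x => |g i x|) (fun i _ => (hg i).abs.aestronglyMeasurable) hp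
  have e1 : (fun x => ∑ i, |g i x|) = ∑ i, fun x => |g i x| := by
    ext x; simp
  rw [e1]
  refine h.trans (le_of_eq (Finset.sum_congr rfl fun i _ => ?_))
  exact eLpNorm_norm (g i)

/-- weighted gradient estimate. For every `1 < p < ∞` there is `C > 0`
such that `‖(1+|x|^{α-1})∇u‖_p ≤ C (‖Au‖_p + ‖u‖_p)` for all `u ∈ C_c^∞(ℝ^N)`. -/
theorem stmt7 (N : ℕ) (hN : 2 < N) (α β b c : ℝ) (hα : 2 < α) (hβ : α - 2 < β) (hc : 0 < c)
    (p : ℝ≥0∞) (hp1 : 1 < p) (hp2 : p ≠ ⊤) :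
    ∃ C : ℝ≥0, 0 < C ∧
      ∀ u : EuclideanSpace ℝ (Fin N) → ℝ, ContDiff ℝ (⊤ : ℕ∞) u → HasCompactSupport u →
        eLpNorm (fun x => (1 + ‖x‖ ^ (α - 1)) * Real.sqrt (∑ i, (pd u i x) ^ 2)) p volume ≤
          (C : ℝ≥0∞) * (eLpNorm (fun x => opA α β b c u x) p volume
            + eLpNorm u p volume) := by
  obtain ⟨M, hM, hintg⟩ := interp N α hα p hp1 hp2
  obtain ⟨K, hK, hpot⟩ := pot_bound2 N α β b c hα hβ hc p hp1 hp2
  set A : ℝ := 2 ^ α with hA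
  have hA0 : 0 < A := by positivity
  set ε : ℝ := 1 / (2 * (1 + N * M * A * |b|)) with hε
  have hpos : 0 ≤ N * M * A * |b| := by positivity
  have hε0 : 0 < ε := by positivity
  have hε1 : ε ≤ 1 / 2 := by
    rw [hε, div_le_div_iff₀ (by positivity) (by norm_num)]; linarith
  have hε2 : N * M * ε * A * |b| ≤ 1 / 2 := by
    have : N * M * ε * A * |b| = (N * M * A * |b|) / (2 * (1 + N * M * A * |b|)) := by
      rw [hε]; ring
    rw [this, div_le_div_iff₀ (by positivity) (by norm_num)]; linarith
  set C₀ : ℝ := 2 * (2 * (N * (M / ε * K + M * ε * (A * (1 + c * K))))) with hC₀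
  have hC₀0 : 0 ≤ C₀ := by positivity
  refine ⟨Real.toNNReal (C₀ + 1), Real.toNNReal_pos.2 (by linarith), ?_⟩
  intro u hu hs
  have hr1 : ∀ s : ℝ, Continuous fun x : EuclideanSpace ℝ (Fin N) => (1 + ‖x‖) ^ s := fun s =>
    (continuous_const.add continuous_norm).rpow_const fun x =>
      Or.inl (by positivity : (1 : ℝ) + ‖x‖ ≠ 0)
  have hβ0 : 0 < β := by linarith
  have hAc := opA_cont α β b c hα hβ0 hu
  have hAs := opA_supp α β b c hs
  have hp1' : 1 ≤ p := hp1.le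
  have hmem : ∀ f : EuclideanSpace ℝ (Fin N) → ℝ, Continuous f → HasCompactSupport f →
      MemLp f p volume := fun f h1 h2 => h1.memLp_of_hasCompactSupport h2
  have hgc : ∀ i, Continuous fun x => (1 + ‖x‖) ^ (α - 1) * pd u i x := fun i =>
    (hr1 _).mul (pd_contDiff hu i).continuous
  have hgs : ∀ i, HasCompactSupport fun x => (1 + ‖x‖) ^ (α - 1) * pd u i x := fun i =>
    (pd_supp hs i).mul_left
  have hvc : Continuous fun x => (1 + ‖x‖) ^ β * u x := (hr1 _).mul hu.continuous
  have hvs : HasCompactSupport fun x => (1 + ‖x‖) ^ β * u x := hs.mul_left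
  set E := eLpNorm (fun x => opA α β b c u x) p volume + eLpNorm u p volume with hE
  set S := ∑ i, eLpNorm (fun x => (1 + ‖x‖) ^ (α - 1) * pd u i x) p volume with hS
  have hEtop : E ≠ ⊤ := ENNReal.add_ne_top.2
    ⟨(hmem _ hAc hAs).eLpNorm_ne_top, (hmem _ hu.continuous hs).eLpNorm_ne_top⟩
  have hStop : S ≠ ⊤ := ENNReal.sum_ne_top.2 fun i _ => (hmem _ (hgc i) (hgs i)).eLpNorm_ne_top
  have hV : eLpNorm (fun x => (1 + ‖x‖) ^ β * u x) p volume ≤ ENNReal.ofReal K * E := hpot u hu hs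
  have hF : eLpNorm (fun x => opA α β b c u x) p volume ≤ E := le_self_add
  have hU : eLpNorm (fun x => (1 + ‖x‖) ^ (α - 2) * u x) p volume ≤ ENNReal.ofReal K * E := by
    refine le_trans (eLpNorm_mono fun x => ?_) hV
    rw [norm_mul, norm_mul]
    apply mul_le_mul_of_nonneg_right _ (norm_nonneg _)
    rw [Real.norm_of_nonneg (by positivity), Real.norm_of_nonneg (by positivity)]
    exact Real.rpow_le_rpow_of_exponent_le (by linarith [norm_nonneg x]) hβ.le
  have hsumS : eLpNorm (fun x => ∑ i, |(1 + ‖x‖) ^ (α - 1) * pd u i x|) p volume ≤ S := by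
    exact eLp_sum_abs p hp1' _ hgc
  have hL : eLpNorm (fun x => (1 + ‖x‖) ^ α * lap u x) p volume
      ≤ ENNReal.ofReal A * (E + ENNReal.ofReal |b| * S + ENNReal.ofReal c * (ENNReal.ofReal K * E)) := by
    refine (eLp_dom p A hA0.le (lap_ptw α β b c hα hβ hc u)).trans ?_
    gcongr
    have c1 : Continuous fun x => |opA α β b c u x| := hAc.abs
    have c2 : Continuous fun x => |b| * ∑ i, |(1 + ‖x‖) ^ (α - 1) * pd u i x| :=
      continuous_const.mul (continuous_finsetSum _ fun i _ => (hgc i).abs)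
    have c3 : Continuous fun x => c * |(1 + ‖x‖) ^ β * u x| := continuous_const.mul hvc.abs
    refine (eLpNorm_add_le (f := fun x => |opA α β b c u x| +
      |b| * ∑ i, |(1 + ‖x‖) ^ (α - 1) * pd u i x|) (c1.add c2).aestronglyMeasurable
      c3.aestronglyMeasurable hp1').trans (add_le_add ?_ ?_)
    · refine (eLpNorm_add_le c1.aestronglyMeasurable
        c2.aestronglyMeasurable hp1').trans (add_le_add ?_ ?_)
      · refine le_trans (le_of_eq ?_) hF
        exact eLpNorm_norm (fun x => opA α β b c u x)
      · refine (eLp_dom p |b| (abs_nonneg _)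
          (f := fun x => ∑ i, |(1 + ‖x‖) ^ (α - 1) * pd u i x|) fun x => ?_).trans ?_
        · rw [abs_mul, abs_abs]
        · gcongr
    · refine (eLp_dom p c hc.le (f := fun x => (1 + ‖x‖) ^ β * u x) fun x => ?_).trans ?_
      · rw [abs_mul, abs_abs, abs_of_pos hc]
      · gcongr
  have hS1 : S ≤ N * (ENNReal.ofReal (M / ε) * (ENNReal.ofReal K * E) + ENNReal.ofReal (M * ε) *
      (ENNReal.ofReal A * (E + ENNReal.ofReal |b| * S + ENNReal.ofReal c * (ENNReal.ofReal K * E)))) := by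
    calc S ≤ ∑ _i : Fin N, (ENNReal.ofReal (M / ε) * (ENNReal.ofReal K * E) + ENNReal.ofReal (M * ε) *
      (ENNReal.ofReal A * (E + ENNReal.ofReal |b| * S + ENNReal.ofReal c * (ENNReal.ofReal K * E)))) := by
          apply Finset.sum_le_sum
          intro i _
          refine (hintg u hu hs ε hε0 hε1 i).trans ?_
          gcongr
      _ = _ := by
        rw [Finset.sum_const, Finset.card_univ, Fintype.card_fin, nsmul_eq_mul]
  -- pass to real numbers
  have hS2 : S ≤ ENNReal.ofReal (2 * (N * (M / ε * K + M * ε * (A * (1 + c * K))))) * E := by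
    lift E to ℝ≥0 using hEtop with e
    lift S to ℝ≥0 using hStop with s
    have he : ((e : ℝ≥0∞)) = ENNReal.ofReal (e : ℝ) := (ENNReal.ofReal_coe_nnreal).symm
    have hss : ((s : ℝ≥0∞)) = ENNReal.ofReal (s : ℝ) := (ENNReal.ofReal_coe_nnreal).symm
    have hNN : (N : ℝ≥0∞) = ENNReal.ofReal (N : ℝ) := (ENNReal.ofReal_natCast N).symm
    have e0 : (0 : ℝ) ≤ e := e.2
    have s0 : (0 : ℝ) ≤ s := s.2
    rw [he, hss, hNN, ← ENNReal.ofReal_mul hK, ← ENNReal.ofReal_mul (by positivity),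
      ← ENNReal.ofReal_mul (by positivity), ← ENNReal.ofReal_mul (by positivity),
      ← ENNReal.ofReal_add (by positivity) (by positivity),
      ← ENNReal.ofReal_add (by positivity) (by positivity),
      ← ENNReal.ofReal_mul (by positivity), ← ENNReal.ofReal_mul (by positivity),
      ← ENNReal.ofReal_add (by positivity) (by positivity), ← ENNReal.ofReal_mul (by positivity),
      ENNReal.ofReal_le_ofReal_iff (by positivity)] at hS1
    rw [he, hss, ← ENNReal.ofReal_mul (by positivity)]
    apply ENNReal.ofReal_le_ofReal
    have h1 : N * M * ε * A * |b| * s ≤ 1 / 2 * s := mul_le_mul_of_nonneg_right hε2 s0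
    nlinarith
  have hfin : eLpNorm (fun x => (1 + ‖x‖ ^ (α - 1)) * Real.sqrt (∑ i, (pd u i x) ^ 2)) p volume
      ≤ ENNReal.ofReal 2 * S := by
    refine (eLp_dom p 2 (by norm_num)
      (f := fun x => ∑ i, |(1 + ‖x‖) ^ (α - 1) * pd u i x|) fun x => ?_).trans ?_
    · have e1 : ∑ i, |(1 + ‖x‖) ^ (α - 1) * pd u i x|
          = (1 + ‖x‖) ^ (α - 1) * ∑ i, |pd u i x| := by
        rw [Finset.mul_sum]
        apply Finset.sum_congr rfl
        intro i _
        rw [abs_mul, abs_of_nonneg (by positivity)]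
      have hs0 : 0 ≤ ∑ i, |pd u i x| := Finset.sum_nonneg fun i _ => abs_nonneg _
      rw [e1, abs_of_nonneg (by positivity), abs_of_nonneg (by positivity), ← mul_assoc]
      have h1 : ‖x‖ ^ (α - 1) ≤ (1 + ‖x‖) ^ (α - 1) :=
        Real.rpow_le_rpow (norm_nonneg x) (by linarith) (by linarith)
      have h2 : 1 ≤ (1 + ‖x‖) ^ (α - 1) :=
        Real.one_le_rpow (by linarith [norm_nonneg x]) (by linarith)
      have h3 := sqrt_sum_le fun i => pd u i x
      exact mul_le_mul (by linarith) h3 (Real.sqrt_nonneg _) (by positivity)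
    · gcongr
  calc _ ≤ ENNReal.ofReal 2 * S := hfin
    _ ≤ ENNReal.ofReal 2 *
        (ENNReal.ofReal (2 * (N * (M / ε * K + M * ε * (A * (1 + c * K))))) * E) := by gcongr
    _ = ENNReal.ofReal C₀ * E := by
      rw [← mul_assoc, ← ENNReal.ofReal_mul (by norm_num)]
    _ ≤ ENNReal.ofReal (C₀ + 1) * E := by
      gcongr; linarith
    _ = _ := rfl
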